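/- arXiv:2109.01205 — 8 statements merged into one kernel-verified Lean document; each statement's English description precedes it below -/
import Mathlib

section
/- Let G be a directed hypergraph in which every hyperedge has exactly one tail node. Then G satisfies condition LCR-hyper if and only if the underlying directed simple graph of G satisfies condition LCR-p2p. -/
open scoped Classical

noncomputable section

/-- A directed hypergraph: a finite node set and a finite set of directed
hyperedges, each given as a pair (head, tail set). -/
structure DirHypergraph (α : Type) [DecidableEq α] where
  V : Finset α
  E : Finset (α × Finset α)

variable {α : Type} [DecidableEq α]

namespace DirHypergraph

/-- Well-formedness: each hyperedge has its head in `V`, its (nonempty) tail set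
inside `V`, and the head is not a tail. -/
def IsValid (G : DirHypergraph α) : Prop :=
  ∀ e ∈ G.E, e.1 ∈ G.V ∧ e.2 ⊆ G.V ∧ e.2.Nonempty ∧ e.1 ∉ e.2

/-- `u` is an in-neighbor of `v`: some hyperedge has head `u` and `v` among its tails. -/
def IsInNbr (G : DirHypergraph α) (u v : α) : Prop :=
  ∃ e ∈ G.E, e.1 = u ∧ v ∈ e.2

/-- `N_G(A, B)`: the nodes of `A` that are in-neighbors of some node of `B`. -/
def inNbrs (G : DirHypergraph α) (A B : Finset α) : Finset α :=
  A.filter (fun u => ∃ v ∈ B, G.IsInNbr u v)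

/-- `A →_G B`: `B = ∅` or `B` has at least `f + 1` in-neighbors in `A`. -/
def Adjacent (f : ℕ) (G : DirHypergraph α) (A B : Finset α) : Prop :=
  B = ∅ ∨ f + 1 ≤ (G.inNbrs A B).card

end DirHypergraph

/-- The node type of hypergraphs obtained by splitting: `Sum.inl v` is an unsplit
node `v`, and `Sum.inr (v, b)` is the copy `v^b` of a split node `v`. -/
abbrev SplitNode (α : Type) := α ⊕ (α × Bool)

/-- The original node that a node of a split hypergraph corresponds to. -/
def SplitNode.base : SplitNode α → α
  | Sum.inl v => v
  | Sum.inr (v, _) => v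

namespace DirHypergraph

/-- The copies of a node `v` after splitting the nodes in `X`. -/
def splitCopies (X : Finset α) (v : α) : Finset (SplitNode α) :=
  if v ∈ X then {Sum.inr (v, false), Sum.inr (v, true)} else {Sum.inl v}

/-- The image of a node set under splitting the nodes in `X`. -/
def splitSet (X : Finset α) (S : Finset α) : Finset (SplitNode α) :=
  S.biUnion (splitCopies X)

/-- The hypergraph obtained from `G` by splitting the nodes of `X`, where each
hyperedge `e` whose head is split is assigned to the copy `(H(e))^(a e)`. -/
def splitGraph (G : DirHypergraph α) (X : Finset α) (a : α × Finset α → Bool) :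
    DirHypergraph (SplitNode α) where
  V := splitSet X G.V
  E := G.E.image (fun e =>
    (if e.1 ∈ X then Sum.inr (e.1, a e) else Sum.inl e.1, splitSet X e.2))

/-- `Λ_F(G)`: all hypergraphs obtainable from `G` by splitting a subset of `F`,
over all choices of the subset and of the head assignments. -/
def splits (G : DirHypergraph α) (F : Finset α) : Set (DirHypergraph (SplitNode α)) :=
  { G' | ∃ X, X ⊆ F ∧ ∃ a : α × Finset α → Bool, G' = G.splitGraph X a }

/-- `F'`: the nodes of a split hypergraph `G'` that correspond to nodes of `F`. -/
def corr (G' : DirHypergraph (SplitNode α)) (F : Finset α) : Finset (SplitNode α) :=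
  G'.V.filter (fun x => x.base ∈ F)

end DirHypergraph

/-- `(L, C, R)` is a partition (with possibly empty parts) of the set `W`. -/
def Partition3 {γ : Type} [DecidableEq γ] (L C R W : Finset γ) : Prop :=
  Disjoint L C ∧ Disjoint L R ∧ Disjoint C R ∧ L ∪ C ∪ R = W

namespace DirHypergraph

/-- Condition LCR-hyper with parameter `F`. -/
def CondLCRHyperWith (f : ℕ) (G : DirHypergraph α) (F : Finset α) : Prop :=
  ∀ G' ∈ G.splits F, ∀ L C R : Finset (SplitNode α),
    Partition3 L C R G'.V →
      Adjacent f G' (L ∪ C) (R \ G'.corr F) ∨ Adjacent f G' (R ∪ C) (L \ G'.corr F)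

/-- Condition LCR-hyper. -/
def CondLCRHyper (f : ℕ) (G : DirHypergraph α) : Prop :=
  ∀ F ⊆ G.V, F.card ≤ f → CondLCRHyperWith f G F

end DirHypergraph

/-- A directed simple graph on a finite node set. -/
structure FinDigraph (α : Type) [DecidableEq α] where
  V : Finset α
  E : Finset (α × α)

/-- The underlying directed simple graph of a directed hypergraph. -/
def DirHypergraph.underlying (G : DirHypergraph α) : FinDigraph α where
  V := G.V
  E := (G.V ×ˢ G.V).filter (fun p => G.IsInNbr p.1 p.2)

namespace FinDigraph

/-- The in-neighbors in `A` of nodes of `B`. -/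
def inNbrs (H : FinDigraph α) (A B : Finset α) : Finset α :=
  A.filter (fun u => ∃ v ∈ B, (u, v) ∈ H.E)

/-- `A →_H B`: `B = ∅` or `B` has at least `f + 1` in-neighbors in `A`. -/
def Adjacent (f : ℕ) (H : FinDigraph α) (A B : Finset α) : Prop :=
  B = ∅ ∨ f + 1 ≤ (H.inNbrs A B).card

/-- Condition LCR-p2p with parameter `F`. -/
def CondLCRp2pWith (f : ℕ) (H : FinDigraph α) (F : Finset α) : Prop :=
  ∀ L C R : Finset α, Partition3 L C R (H.V \ F) →
    Adjacent f H (L ∪ C) R ∨ Adjacent f H (R ∪ C) L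

/-- Condition LCR-p2p. -/
def CondLCRp2p (f : ℕ) (H : FinDigraph α) : Prop :=
  ∀ F ⊆ H.V, F.card ≤ f → CondLCRp2pWith f H F

/-- Condition LCR-local with parameter `F`. -/
def CondLCRlocalWith (f : ℕ) (H : FinDigraph α) (F : Finset α) : Prop :=
  ∀ L C R : Finset α, Partition3 L C R H.V →
    Adjacent f H (L ∪ C) (R \ F) ∨ Adjacent f H (R ∪ C) (L \ F)

/-- Condition LCR-local. -/
def CondLCRlocal (f : ℕ) (H : FinDigraph α) : Prop :=
  ∀ F ⊆ H.V, F.card ≤ f → CondLCRlocalWith f H F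

end FinDigraph

namespace DirHypergraph

/-- `G` is bidirectional: the in-neighbor relation is symmetric. -/
def Bidirectional (G : DirHypergraph α) : Prop :=
  ∀ u v, G.IsInNbr u v ↔ G.IsInNbr v u

end DirHypergraph

/-- The graph with vertex set `V` and (symmetric) adjacency `adj` is connected:
`V` is nonempty and any two vertices of `V` are joined by a walk inside `V`. -/
def UConnected {γ : Type} [DecidableEq γ] (V : Finset γ) (adj : γ → γ → Prop) : Prop :=
  V.Nonempty ∧ ∀ u ∈ V, ∀ v ∈ V,
    Relation.ReflTransGen (fun a b => a ∈ V ∧ b ∈ V ∧ adj a b) u v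

/-- `k`-connectivity of the graph with vertex set `V` and adjacency `adj`:
`|V| ≥ k + 1` and deleting any set of fewer than `k` vertices leaves it connected. -/
def KConnected {γ : Type} [DecidableEq γ] (V : Finset γ) (adj : γ → γ → Prop) (k : ℕ) : Prop :=
  k + 1 ≤ V.card ∧ ∀ D ⊆ V, D.card < k → UConnected (V \ D) adj

namespace DirHypergraph

/-- `G` is an undirected hypergraph: every hyperedge can be reversed around any tail. -/
def IsUndirected (G : DirHypergraph α) : Prop :=
  ∀ e ∈ G.E, ∀ v ∈ e.2, (v, (e.2 \ {v}) ∪ {e.1}) ∈ G.E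

/-- The node set `W` is contained in an undirected hyperedge of `G`. -/
def InUHyperedge (G : DirHypergraph α) (W : Finset α) : Prop :=
  ∃ e ∈ G.E, W ⊆ insert e.1 e.2

/-- A path in a directed hypergraph: an alternating sequence of distinct nodes
and distinct hyperedges, recorded as the node list and the hyperedge list. -/
structure HPath (G : DirHypergraph α) where
  nodes : List α
  edges : List (α × Finset α)
  length_eq : nodes.length = edges.length + 1
  edges_ne : edges ≠ []
  nodes_nodup : nodes.Nodup
  edges_nodup : edges.Nodup
  edges_mem : ∀ e ∈ edges, e ∈ G.E
  head_eq : ∀ (i : ℕ) (h : i < edges.length),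
    (edges.get ⟨i, h⟩).1 = nodes.get ⟨i, by omega⟩
  tail_mem : ∀ (i : ℕ) (h : i < edges.length),
    nodes.get ⟨i + 1, by omega⟩ ∈ (edges.get ⟨i, h⟩).2

/-- The source (first node) of a path. -/
def HPath.source {G : DirHypergraph α} (P : HPath G) : α :=
  P.nodes.get ⟨0, by have := P.length_eq; omega⟩

/-- The terminal (last node) of a path. -/
def HPath.terminal {G : DirHypergraph α} (P : HPath G) : α :=
  P.nodes.get ⟨P.nodes.length - 1, by have := P.length_eq; omega⟩

/-- `A ⇒_G B`: `B = ∅`, or every `v ∈ B` is the terminal of at least `f + 1`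
pairwise node-disjoint paths of `G` starting in `A`. -/
def Propagates (f : ℕ) (G : DirHypergraph α) (A B : Finset α) : Prop :=
  B = ∅ ∨ ∀ v ∈ B, ∃ P : Fin (f + 1) → HPath G,
    (∀ i, (P i).source ∈ A ∧ (P i).terminal = v) ∧
    (∀ i j, i ≠ j → ∀ x, x ∈ (P i).nodes → x ∈ (P j).nodes → x = v)

/-- `G[U]`: the sub-hypergraph induced by the node set `U`. -/
def induced (G : DirHypergraph α) (U : Finset α) : DirHypergraph α where
  V := U
  E := ((G.E.filter (fun e => e.1 ∈ U)).image (fun e => (e.1, e.2 ∩ U))).filter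
        (fun e => e.2.Nonempty)

/-- `G − U`: the sub-hypergraph induced by `V \ U`. -/
def remove (G : DirHypergraph α) (U : Finset α) : DirHypergraph α :=
  G.induced (G.V \ U)

/-- Condition AB-hyper with parameter `F`. -/
def CondABHyperWith (f : ℕ) (G : DirHypergraph α) (F : Finset α) : Prop :=
  ∀ G' ∈ G.splits F, ∀ A B : Finset (SplitNode α),
    Disjoint A B → A ∪ B = G'.V →
      Propagates f (G'.remove (B ∩ G'.corr F)) A (B \ G'.corr F) ∨
      Propagates f (G'.remove (A ∩ G'.corr F)) B (A \ G'.corr F)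

/-- Condition AB-hyper. -/
def CondABHyper (f : ℕ) (G : DirHypergraph α) : Prop :=
  ∀ F ⊆ G.V, F.card ≤ f → CondABHyperWith f G F

/-- `G` is strongly connected: any two distinct nodes are joined by a path. -/
def StronglyConnected (G : DirHypergraph α) : Prop :=
  ∀ u ∈ G.V, ∀ v ∈ G.V, u ≠ v → ∃ P : HPath G, P.source = u ∧ P.terminal = v

/-- `S` is a maximal strongly connected component of `G`. -/
def IsSCC (G : DirHypergraph α) (S : Finset α) : Prop :=
  S.Nonempty ∧ S ⊆ G.V ∧ StronglyConnected (G.induced S) ∧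
    ∀ T, S ⊆ T → T ⊆ G.V → StronglyConnected (G.induced T) → T = S

/-- `S` is a source component of (the directed decomposition of) `G`. -/
def IsSourceComponent (G : DirHypergraph α) (S : Finset α) : Prop :=
  IsSCC G S ∧ ∀ u ∈ G.V, u ∉ S → ∀ v ∈ S, ¬ G.IsInNbr u v

end DirHypergraph


namespace LCRaux

open DirHypergraph

theorem mem_inl {α : Type} [DecidableEq α] (X S : Finset α) (v : α) :
    (Sum.inl v : SplitNode α) ∈ splitSet X S ↔ v ∈ S ∧ v ∉ X := by
  unfold splitSet splitCopies
  simp only [Finset.mem_biUnion]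
  constructor
  · rintro ⟨w, hw, h⟩
    split_ifs at h with hX
    · simp at h
    · simp at h; subst h; exact ⟨hw, hX⟩
  · rintro ⟨h1, h2⟩
    exact ⟨v, h1, by simp [h2]⟩

theorem mem_inr {α : Type} [DecidableEq α] (X S : Finset α) (v : α) (b : Bool) :
    (Sum.inr (v, b) : SplitNode α) ∈ splitSet X S ↔ v ∈ S ∧ v ∈ X := by
  unfold splitSet splitCopies
  simp only [Finset.mem_biUnion]
  constructor
  · rintro ⟨w, hw, h⟩
    split_ifs at h with hX
    · have : v = w := by
        simp at h; rcases h with h | h <;> exact h.1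
      subst this; exact ⟨hw, hX⟩
    · simp at h
  · rintro ⟨h1, h2⟩
    exact ⟨v, h1, by cases b <;> simp [h2]⟩

theorem back {α : Type} [DecidableEq α] (f : ℕ) (G : DirHypergraph α) (F X : Finset α)
    (hX : X ⊆ F) (a : α × Finset α → Bool) (A' B' : Finset (SplitNode α))
    (A B : Finset α)
    (hA : ∀ u ∈ A, u ∉ F ∧ Sum.inl u ∈ A') (hB : ∀ u, u ∈ B ↔ u ∉ F ∧ Sum.inl u ∈ B')
    (hBV : B' ⊆ (G.splitGraph X a).V)
    (h : FinDigraph.Adjacent f G.underlying A B) :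
    Adjacent f (G.splitGraph X a) A' (B' \ (G.splitGraph X a).corr F) := by
  rcases h with h | h
  · left
    rw [Finset.eq_empty_iff_forall_notMem]
    intro x hx
    rw [Finset.mem_sdiff] at hx
    obtain ⟨hx1, hx2⟩ := hx
    have hxV := hBV hx1
    have hxF : x.base ∉ F := fun hc => hx2 (by unfold corr; exact Finset.mem_filter.2 ⟨hxV, hc⟩)
    rcases x with v | ⟨v, b⟩
    · have : v ∈ B := (hB v).2 ⟨hxF, hx1⟩
      simp [h] at this
    · exact hxF (hX ((mem_inr X G.V v b).1 hxV).2)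
  · right
    refine h.trans ?_
    rw [← Finset.card_image_of_injective (f := (Sum.inl : α → SplitNode α)) _ Sum.inl_injective]
    apply Finset.card_le_card
    intro x hx
    obtain ⟨u, hu, rfl⟩ := Finset.mem_image.1 hx
    unfold FinDigraph.inNbrs at hu
    obtain ⟨hu, v, hv, huv⟩ := Finset.mem_filter.1 hu
    obtain ⟨-, e, he, he1, he2⟩ := Finset.mem_filter.1 huv
    simp only at he1 he2
    have hvB := (hB v).1 hv
    unfold DirHypergraph.inNbrs
    refine Finset.mem_filter.2 ⟨(hA u hu).2, Sum.inl v, ?_, ?_⟩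
    · rw [Finset.mem_sdiff]
      refine ⟨hvB.2, fun hc => hvB.1 ?_⟩
      exact (Finset.mem_filter.1 hc).2
    · refine ⟨_, Finset.mem_image_of_mem _ he, ?_, ?_⟩
      · have : e.1 ∉ X := fun hc => (hA u hu).1 (hX (he1 ▸ hc))
        subst he1; simp [this]
      · exact (mem_inl X e.2 v).2 ⟨he2, fun hc => hvB.1 (hX hc)⟩

theorem forth {α : Type} [DecidableEq α] (f : ℕ) (G : DirHypergraph α)
    (hvalid : G.IsValid) (F : Finset α)
    (a : α × Finset α → Bool) (A' B' : Finset (SplitNode α))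
    (A B : Finset α) (c : Bool)
    (hA : ∀ u, Sum.inl u ∈ A' → u ∈ A) 
    (hB : ∀ u, Sum.inl u ∈ B' ↔ u ∈ B)
    (hBF : ∀ u ∈ B, u ∉ F)
    (hA' : ∀ u, Sum.inr (u, c) ∉ A')
    (hBV : B' ⊆ (G.splitGraph F a).V)
    (ha : ∀ e ∈ G.E, ∀ w ∈ e.2, w ∈ B → a e = c)
    (h : Adjacent f (G.splitGraph F a) A' (B' \ (G.splitGraph F a).corr F)) :
    FinDigraph.Adjacent f G.underlying A B := by
  rcases h with h | h
  · left
    rw [Finset.eq_empty_iff_forall_notMem] at h ⊢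
    intro u hu
    apply h (Sum.inl u)
    rw [Finset.mem_sdiff]
    exact ⟨(hB u).2 hu, fun hc => hBF u hu (Finset.mem_filter.1 hc).2⟩
  · right
    refine h.trans ?_
    rw [← Finset.card_image_of_injective (f := (Sum.inl : α → SplitNode α))
      (G.underlying.inNbrs A B) Sum.inl_injective]
    apply Finset.card_le_card
    intro x hx
    obtain ⟨hxA, v, hv, e', he', he1, he2⟩ := Finset.mem_filter.1 hx
    obtain ⟨e, he, rfl⟩ := Finset.mem_image.1 he'
    rw [Finset.mem_sdiff] at hv
    have hvV := hBV hv.1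
    have hvF : v.base ∉ F := fun hc => hv.2 (by unfold corr; exact Finset.mem_filter.2 ⟨hvV, hc⟩)
    rcases v with w | ⟨w, b⟩
    · have hwB := (hB w).1 hv.1
      have hwe := ((mem_inl F e.2 w).1 he2).1
      have hae := ha e he w hwe hwB
      by_cases heF : e.1 ∈ F
      · simp only [heF, if_true, hae] at he1
        subst he1
        exact absurd hxA (hA' _)
      · simp only [heF, if_false] at he1
        subst he1
        refine Finset.mem_image_of_mem _ (Finset.mem_filter.2 ⟨hA _ hxA, w, hwB, ?_⟩)
        have := hvalid e he
        exact Finset.mem_filter.2 ⟨Finset.mem_product.2 ⟨this.1, this.2.1 hwe⟩, e, he, rfl, hwe⟩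
    · exact absurd ((mem_inr F G.V w b).1 hvV).2 hvF

end LCRaux

/-- A directed hypergraph in which every hyperedge has exactly one
tail node satisfies condition LCR-hyper iff its underlying directed simple graph
satisfies condition LCR-p2p. -/
theorem stmt_1 {α : Type} [DecidableEq α] (f : ℕ) (G : DirHypergraph α)
    (hvalid : G.IsValid)
    (hsingle : ∀ e ∈ G.E, e.2.card = 1) :
    G.CondLCRHyper f ↔ FinDigraph.CondLCRp2p f G.underlying := by
  constructor
  · intro h F hF hc L C R ⟨h1, h2, h3, h4⟩
    have hmem : ∀ u, (u ∈ L ∨ u ∈ C) ∨ u ∈ R ↔ u ∈ G.V ∧ u ∉ F := by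
      intro u
      have : u ∈ L ∪ C ∪ R ↔ u ∈ G.V \ F := by rw [h4]; rfl
      simpa [or_assoc] using this
    rw [Finset.disjoint_left] at h1 h2 h3
    have hFV : ∀ u ∈ F, u ∈ G.V := fun u hu => hF hu
    let a : α × Finset α → Bool := fun e => decide (∃ v ∈ e.2, v ∈ R)
    let L' : Finset (SplitNode α) := L.image Sum.inl ∪ F.image (fun v => Sum.inr (v, false))
    let C' : Finset (SplitNode α) := C.image Sum.inl
    let R' : Finset (SplitNode α) := R.image Sum.inl ∪ F.image (fun v => Sum.inr (v, true))
    have hP : Partition3 L' C' R' (G.splitGraph F a).V := by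
      refine ⟨?_, ?_, ?_, ?_⟩
      · rw [Finset.disjoint_left]
        rintro (v | ⟨v, b⟩) <;> simp [L', C']
        exact @h1 v
      · rw [Finset.disjoint_left]
        rintro (v | ⟨v, b⟩) <;> simp [L', R']
        · exact @h2 v
        · rintro _ rfl; simp
      · rw [Finset.disjoint_left]
        rintro (v | ⟨v, b⟩) <;> simp [R', C']
        exact @h3 v
      · ext x
        change _ ↔ x ∈ DirHypergraph.splitSet F G.V
        rcases x with v | ⟨v, b⟩
        · rw [LCRaux.mem_inl, ← hmem]
          simp [L', C', R', or_assoc]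
        · rw [LCRaux.mem_inr]
          have := hFV v
          cases b <;> simp [L', C', R'] <;> exact this
    have hVL : L' ⊆ (G.splitGraph F a).V := by
      rw [← hP.2.2.2]; intro x hx; simp [hx]
    have hVR : R' ⊆ (G.splitGraph F a).V := by
      rw [← hP.2.2.2]; intro x hx; simp [hx]
    rcases h F hF hc _ ⟨F, subset_rfl, a, rfl⟩ L' C' R' hP with h | h
    · left
      refine LCRaux.forth f G hvalid F a _ _ _ _ true ?_ ?_ ?_ ?_ hVR ?_ h
      · intro u; simp [L', C']
      · intro u; simp [R']
      · intro u hu; exact ((hmem u).1 (Or.inr hu)).2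
      · intro u; simp [L', C']
      · intro e he w hw hwR
        simp only [a, decide_eq_true_eq]; exact ⟨w, hw, hwR⟩
    · right
      refine LCRaux.forth f G hvalid F a _ _ _ _ false ?_ ?_ ?_ ?_ hVL ?_ h
      · intro u; simp [R', C']
      · intro u; simp [L']
      · intro u hu; exact ((hmem u).1 (Or.inl (Or.inl hu))).2
      · intro u; simp [R', C']
      · intro e he w hw hwL
        simp only [a, decide_eq_false_iff_not]
        rintro ⟨v, hv, hvR⟩
        obtain rfl : v = w := Finset.card_le_one.1 (hsingle e he).le v hv w hw
        exact h2 hwL hvR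
  · rintro h F hF hc _ ⟨X, hX, a, rfl⟩ L' C' R' ⟨h1, h2, h3, h4⟩
    rw [Finset.disjoint_left] at h1 h2 h3
    let P : Finset (SplitNode α) → Finset α := fun S =>
      (G.V \ F).filter (fun v => Sum.inl v ∈ S)
    have hV : ∀ v, v ∉ F → ((Sum.inl v : SplitNode α) ∈ L' ∪ C' ∪ R' ↔ v ∈ G.V) := by
      intro v hv
      rw [h4]
      change _ ∈ DirHypergraph.splitSet X G.V ↔ _
      rw [LCRaux.mem_inl]
      exact ⟨fun h => h.1, fun h => ⟨h, fun hc => hv (hX hc)⟩⟩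
    have hVL : L' ⊆ (G.splitGraph X a).V := by
      rw [← h4]; intro x hx; simp [hx]
    have hVR : R' ⊆ (G.splitGraph X a).V := by
      rw [← h4]; intro x hx; simp [hx]
    have hPL : ∀ u, u ∈ P L' ↔ u ∉ F ∧ Sum.inl u ∈ L' := by
      intro u
      simp only [P, Finset.mem_filter, Finset.mem_sdiff]
      exact ⟨fun h => ⟨h.1.2, h.2⟩, fun h => ⟨⟨(hV u h.1).1 (by simp [h.2]), h.1⟩, h.2⟩⟩
    have hPC : ∀ u, u ∈ P C' ↔ u ∉ F ∧ Sum.inl u ∈ C' := by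
      intro u
      simp only [P, Finset.mem_filter, Finset.mem_sdiff]
      exact ⟨fun h => ⟨h.1.2, h.2⟩, fun h => ⟨⟨(hV u h.1).1 (by simp [h.2]), h.1⟩, h.2⟩⟩
    have hPR : ∀ u, u ∈ P R' ↔ u ∉ F ∧ Sum.inl u ∈ R' := by
      intro u
      simp only [P, Finset.mem_filter, Finset.mem_sdiff]
      exact ⟨fun h => ⟨h.1.2, h.2⟩, fun h => ⟨⟨(hV u h.1).1 (by simp [h.2]), h.1⟩, h.2⟩⟩
    have hP : Partition3 (P L') (P C') (P R') (G.underlying.V \ F) := by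
      refine ⟨?_, ?_, ?_, ?_⟩
      · rw [Finset.disjoint_left]
        intro u hu hu'; exact h1 ((hPL u).1 hu).2 ((hPC u).1 hu').2
      · rw [Finset.disjoint_left]
        intro u hu hu'; exact h2 ((hPL u).1 hu).2 ((hPR u).1 hu').2
      · rw [Finset.disjoint_left]
        intro u hu hu'; exact h3 ((hPC u).1 hu).2 ((hPR u).1 hu').2
      · ext u
        change _ ↔ u ∈ G.V \ F
        simp only [Finset.mem_union, hPL, hPC, hPR, Finset.mem_sdiff]
        have := hV u
        simp only [Finset.mem_union] at this
        tauto
    rcases h F hF hc _ _ _ hP with h | h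
    · left
      refine LCRaux.back f G F X hX a _ _ _ _ ?_ hPR hVR h
      intro u hu
      simp only [Finset.mem_union, hPL, hPC] at hu ⊢
      tauto
    · right
      refine LCRaux.back f G F X hX a _ _ _ _ ?_ hPL hVL h
      intro u hu
      simp only [Finset.mem_union, hPR, hPC] at hu ⊢
      tauto
end
end

section
/- Let G be a directed hypergraph in which every node is the head of exactly one hyperedge. Then G satisfies condition LCR-hyper if and only if the underlying directed simple graph of G satisfies condition LCR-local. -/
open scoped Classical

noncomputable section

variable {α : Type} [DecidableEq α]

def sendCopy {α : Type} [DecidableEq α] (X : Finset α) (t : α → Bool) (u : α) : SplitNode α :=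
  if u ∈ X then Sum.inr (u, t u) else Sum.inl u

theorem sendCopy_base {α : Type} [DecidableEq α] (X : Finset α) (t : α → Bool) (u : α) :
    (sendCopy X t u).base = u := by
  unfold sendCopy; split_ifs <;> rfl

theorem sendCopy_inj {α : Type} [DecidableEq α] (X : Finset α) (t : α → Bool) :
    Function.Injective (sendCopy X t) := by
  intro u v h
  rw [← sendCopy_base X t u, h, sendCopy_base]

theorem mem_splitSet_sendCopy {α : Type} [DecidableEq α] (X : Finset α) (t : α → Bool)
    (S : Finset α) (u : α) : sendCopy X t u ∈ DirHypergraph.splitSet X S ↔ u ∈ S := by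
  simp only [DirHypergraph.splitSet, DirHypergraph.splitCopies, sendCopy, Finset.mem_biUnion]
  constructor
  · rintro ⟨v, hv, h⟩
    split_ifs at h <;> simp at h <;> grind
  · intro h
    refine ⟨u, h, ?_⟩
    split_ifs <;> simp

theorem eq_sendCopy {α : Type} [DecidableEq α] (X : Finset α) (t : α → Bool)
    (S : Finset α) (x : SplitNode α) (hx : x ∈ DirHypergraph.splitSet X S) (hb : x.base ∉ X) :
    x = sendCopy X t x.base := by
  simp only [DirHypergraph.splitSet, DirHypergraph.splitCopies, Finset.mem_biUnion] at hx
  obtain ⟨v, hv, h⟩ := hx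
  split_ifs at h with hX
  · simp at h
    rcases h with rfl | rfl <;> exact absurd hX hb
  · simp at h
    subst h
    simp [sendCopy, SplitNode.base, hX]

theorem mem_inNbrs_h {α : Type} [DecidableEq α] (G : DirHypergraph α) (A B : Finset α) (u : α) :
    u ∈ G.inNbrs A B ↔ u ∈ A ∧ ∃ v ∈ B, G.IsInNbr u v := by
  unfold DirHypergraph.inNbrs
  exact Finset.mem_filter

theorem mem_inNbrs_d {α : Type} [DecidableEq α] (H : FinDigraph α) (A B : Finset α) (u : α) :
    u ∈ H.inNbrs A B ↔ u ∈ A ∧ ∃ v ∈ B, (u, v) ∈ H.E := by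
  unfold FinDigraph.inNbrs
  exact Finset.mem_filter

theorem mem_underlying {α : Type} [DecidableEq α] (G : DirHypergraph α) (u v : α) :
    (u, v) ∈ G.underlying.E ↔ (u ∈ G.V ∧ v ∈ G.V) ∧ G.IsInNbr u v := by
  unfold DirHypergraph.underlying
  rw [Finset.mem_filter, Finset.mem_product]

theorem adj_key {α : Type} [DecidableEq α] (f : ℕ) (G : DirHypergraph α)
    (hvalid : G.IsValid) (F X : Finset α) (hXF : X ⊆ F) (a : α × Finset α → Bool)
    (t : α → Bool) (ht : ∀ e ∈ G.E, a e = t e.1)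
    (A B : Finset (SplitNode α)) (hB : B ⊆ (G.splitGraph X a).V) :
    DirHypergraph.Adjacent f (G.splitGraph X a) A (B \ (G.splitGraph X a).corr F) ↔
    FinDigraph.Adjacent f G.underlying (G.V.filter (fun u => sendCopy X t u ∈ A))
      (G.V.filter (fun u => sendCopy X t u ∈ B) \ F) := by
  have hBs : B \ (G.splitGraph X a).corr F =
      (G.V.filter (fun u => sendCopy X t u ∈ B) \ F).image (sendCopy X t) := by
    ext x
    simp only [Finset.mem_sdiff, DirHypergraph.corr, Finset.mem_filter, Finset.mem_image, not_and]
    constructor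
    · rintro ⟨hx, h⟩
      have hV := hB hx
      have hF := h hV
      have e := eq_sendCopy X t G.V x hV (fun h => hF (hXF h))
      refine ⟨x.base, ⟨⟨?_, e ▸ hx⟩, hF⟩, e.symm⟩
      have hV' : x ∈ DirHypergraph.splitSet X G.V := hV
      rw [e] at hV'
      exact (mem_splitSet_sendCopy X t G.V _).1 hV'
    · rintro ⟨u, ⟨⟨hu, huB⟩, hF⟩, rfl⟩
      exact ⟨huB, fun _ => by rwa [sendCopy_base]⟩
  have hN : DirHypergraph.inNbrs (G.splitGraph X a) A (B \ (G.splitGraph X a).corr F) =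
      (FinDigraph.inNbrs G.underlying (G.V.filter (fun u => sendCopy X t u ∈ A))
      (G.V.filter (fun u => sendCopy X t u ∈ B) \ F)).image (sendCopy X t) := by
    rw [hBs]
    ext x
    rw [Finset.mem_image]
    simp only [mem_inNbrs_h, mem_inNbrs_d, mem_underlying, Finset.mem_filter, Finset.mem_image,
      DirHypergraph.IsInNbr, DirHypergraph.splitGraph]
    constructor
    · rintro ⟨hx, _, ⟨v, hv, rfl⟩, _, ⟨e, he, rfl⟩, h1, h2⟩
      have h1' : sendCopy X t e.1 = x := by
        rw [← h1, sendCopy, ht e he]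
      have hv2 := (mem_splitSet_sendCopy X t _ _).1 h2
      have hval := hvalid e he
      exact ⟨e.1, ⟨⟨hval.1, h1' ▸ hx⟩, v, hv, ⟨hval.1, hval.2.1 hv2⟩, e, he, rfl, hv2⟩, h1'⟩
    · rintro ⟨u, ⟨⟨hu, huA⟩, v, hv, ⟨_, _⟩, e, he, rfl, hve⟩, rfl⟩
      refine ⟨huA, _, ⟨v, hv, rfl⟩, _, ⟨e, he, rfl⟩, ?_, ?_⟩
      · simp only [sendCopy, ht e he]
      · exact (mem_splitSet_sendCopy X t _ _).2 hve
  unfold DirHypergraph.Adjacent FinDigraph.Adjacent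
  rw [hN, Finset.card_image_of_injective _ (sendCopy_inj X t), hBs, Finset.image_eq_empty]

theorem stmt_3 {α : Type} [DecidableEq α] (f : ℕ) (G : DirHypergraph α)
    (hvalid : G.IsValid)
    (hhead : ∀ v ∈ G.V, (G.E.filter (fun e => e.1 = v)).card = 1) :
    G.CondLCRHyper f ↔ FinDigraph.CondLCRlocal f G.underlying := by
  constructor
  · intro H F hF hc L C R hP
    obtain ⟨h1, h2, h3, h4⟩ := hP
    have h4' : L ∪ C ∪ R = G.V := h4
    have hi : Function.Injective (Sum.inl : α → SplitNode α) := Sum.inl_injective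
    have hVV : (G.splitGraph ∅ fun _ => false).V = G.V.image Sum.inl := by
      ext x
      simp [DirHypergraph.splitGraph, DirHypergraph.splitSet, DirHypergraph.splitCopies, eq_comm]
    have key := H F hF hc (G.splitGraph ∅ (fun _ => false))
      ⟨∅, Finset.empty_subset _, _, rfl⟩ (L.image Sum.inl) (C.image Sum.inl) (R.image Sum.inl)
      ⟨(Finset.disjoint_image hi).2 h1, (Finset.disjoint_image hi).2 h2,
        (Finset.disjoint_image hi).2 h3, by
          rw [hVV, ← Finset.image_union, ← Finset.image_union, h4']⟩
    have hpre : ∀ S ⊆ G.V, G.V.filter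
        (fun u => sendCopy ∅ (fun _ => false) u ∈ S.image Sum.inl) = S := by
      intro S hS
      ext u
      simp [sendCopy]
      exact fun h => hS h
    have hL : L ⊆ G.V := by rw [← h4']; grind
    have hC : C ⊆ G.V := by rw [← h4']; grind
    have hR : R ⊆ G.V := by rw [← h4']; grind
    rw [← Finset.image_union, ← Finset.image_union,
      adj_key f G hvalid F ∅ (Finset.empty_subset _) _ (fun _ => false) (fun _ _ => rfl) _ _
        (by rw [hVV]; exact Finset.image_subset_image hR),
      adj_key f G hvalid F ∅ (Finset.empty_subset _) _ (fun _ => false) (fun _ _ => rfl) _ _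
        (by rw [hVV]; exact Finset.image_subset_image hL),
      hpre _ (Finset.union_subset hL hC), hpre _ (Finset.union_subset hR hC),
      hpre _ hL, hpre _ hR] at key
    exact key
  · rintro H F hF hc _ ⟨X, hXF, a, rfl⟩ L C R ⟨h1, h2, h3, h4⟩
    obtain ⟨t, ht⟩ : ∃ t : α → Bool, ∀ e ∈ G.E, a e = t e.1 := by
      refine ⟨fun v => decide (∃ e ∈ G.E, e.1 = v ∧ a e = true), fun e he => ?_⟩
      have huniq : ∀ e' ∈ G.E, e'.1 = e.1 → e' = e := by
        intro e' he' h
        have hc1 := hhead e.1 (hvalid e he).1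
        exact Finset.card_le_one.1 hc1.le e' (by simp [he', h]) e (by simp [he])
      rw [Bool.eq_iff_iff, decide_eq_true_iff]
      constructor
      · exact fun h => ⟨e, he, rfl, h⟩
      · rintro ⟨e', he', h, h'⟩
        rwa [huniq e' he' h] at h'
    have hR : R ⊆ (G.splitGraph X a).V := by rw [← h4]; grind
    have hL : L ⊆ (G.splitGraph X a).V := by rw [← h4]; grind
    rw [adj_key f G hvalid F X hXF a t ht _ _ hR, adj_key f G hvalid F X hXF a t ht _ _ hL]
    have hun : ∀ S T : Finset (SplitNode α), G.V.filter (fun u => sendCopy X t u ∈ S ∪ T) =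
        G.V.filter (fun u => sendCopy X t u ∈ S) ∪ G.V.filter (fun u => sendCopy X t u ∈ T) := by
      intro S T
      ext u
      simp only [Finset.mem_filter, Finset.mem_union]
      tauto
    have hdis : ∀ S T : Finset (SplitNode α), Disjoint S T →
        Disjoint (G.V.filter (fun u => sendCopy X t u ∈ S))
          (G.V.filter (fun u => sendCopy X t u ∈ T)) := by
      intro S T h
      rw [Finset.disjoint_left] at h ⊢
      intro u hu hu'
      exact h (Finset.mem_filter.1 hu).2 (Finset.mem_filter.1 hu').2
    rw [hun, hun]
    refine H F hF hc _ _ _ ⟨hdis _ _ h1, hdis _ _ h2, hdis _ _ h3, ?_⟩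
    rw [← hun, ← hun, h4]
    ext u
    simp only [Finset.mem_filter]
    exact ⟨fun h => h.1, fun h => ⟨h, (mem_splitSet_sendCopy X t G.V u).2 h⟩⟩
end
end

section
/- A directed hypergraph G satisfies condition LCR-hyper if and only if G satisfies condition AB-hyper. -/
open scoped Classical

noncomputable section

variable {α : Type} [DecidableEq α]

namespace DirHypergraph

section Aux

variable {γ : Type} [DecidableEq γ]

theorem aux_nbr_remove (H : DirHypergraph γ) (D : Finset γ) (u v : γ) :
    (H.remove D).IsInNbr u v ↔ u ∈ H.V \ D ∧ v ∈ H.V \ D ∧ H.IsInNbr u v := by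
  unfold remove induced IsInNbr
  constructor
  · rintro ⟨e, he, rfl, hv⟩
    simp only [Finset.mem_filter, Finset.mem_image] at he
    obtain ⟨⟨e', ⟨he', hU⟩, rfl⟩, -⟩ := he
    simp only [Finset.mem_inter] at hv
    exact ⟨hU, hv.2, e', he', rfl, hv.1⟩
  · rintro ⟨hu, hv, e, he, rfl, hve⟩
    refine ⟨(e.1, e.2 ∩ (H.V \ D)), ?_, rfl, Finset.mem_inter.2 ⟨hve, hv⟩⟩
    simp only [Finset.mem_filter, Finset.mem_image]
    exact ⟨⟨e, ⟨he, hu⟩, rfl⟩, ⟨v, Finset.mem_inter.2 ⟨hve, hv⟩⟩⟩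

theorem aux_cross {H : DirHypergraph γ} (P : HPath H) (S : Finset γ)
    (h0 : P.source ∉ S) (h1 : P.terminal ∈ S) :
    ∃ x ∈ P.nodes, x ∉ S ∧ ∃ y ∈ S, H.IsInNbr x y := by
  by_contra hcon
  push Not at hcon
  have key : ∀ i (h : i < P.nodes.length), P.nodes.get ⟨i, h⟩ ∉ S := by
    intro i
    induction i with
    | zero => intro h; exact h0
    | succ k ih =>
      intro h hS
      have hl := P.length_eq
      have hk : k < P.edges.length := by omega
      refine hcon _ (List.get_mem P.nodes ⟨k, by omega⟩) (ih (by omega)) _ hS ?_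
      exact ⟨_, P.edges_mem _ (List.get_mem P.edges ⟨k, hk⟩), P.head_eq k hk, P.tail_mem k hk⟩
  exact key _ _ h1

theorem aux_prop_adj (f : ℕ) (H : DirHypergraph γ) (D A B S W : Finset γ) (v : γ)
    (hP : Propagates f (H.remove D) A B) (hvB : v ∈ B) (hvS : v ∈ S)
    (hAS : Disjoint A S) (hW : ∀ x ∈ H.V, x ∉ D → x ∉ S → x ∈ W) :
    f + 1 ≤ (H.inNbrs W S).card := by
  rcases hP with rfl | hP
  · simp at hvB
  obtain ⟨P, hst, hdis⟩ := hP v hvB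
  have hx : ∀ i, ∃ x ∈ (P i).nodes, x ∉ S ∧ ∃ y ∈ S, (H.remove D).IsInNbr x y := fun i =>
    aux_cross (P i) S (Finset.disjoint_left.1 hAS (hst i).1) (by rw [(hst i).2]; exact hvS)
  choose x hxn hxS hxy using hx
  have hinj : Function.Injective x := by
    intro i j hij
    by_contra hne
    have := hdis i j hne (x i) (hxn i) (hij ▸ hxn j)
    exact hxS i (this ▸ hvS)
  calc f + 1 = (Finset.univ.image x).card := by
        rw [Finset.card_image_of_injective _ hinj]; simp
    _ ≤ _ := by
      apply Finset.card_le_card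
      intro z hz
      obtain ⟨i, -, rfl⟩ := Finset.mem_image.1 hz
      obtain ⟨y, hy, hn⟩ := hxy i
      rw [aux_nbr_remove] at hn
      obtain ⟨h1, -, h3⟩ := hn
      rw [Finset.mem_sdiff] at h1
      exact Finset.mem_filter.2 ⟨hW _ h1.1 h1.2 (hxS i), y, hy, h3⟩

theorem aux_path (H : DirHypergraph γ) (q : ℕ → γ) (n : ℕ)
    (hinj : ∀ a ≤ n + 1, ∀ b ≤ n + 1, q a = q b → a = b)
    (hn : ∀ m ≤ n, H.IsInNbr (q (m + 1)) (q m)) :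
    ∃ P : HPath H, P.source = q (n + 1) ∧ P.terminal = q 0 ∧
      ∀ x ∈ P.nodes, ∃ k ≤ n + 1, x = q k := by
  have he : ∀ m, ∃ e : γ × Finset γ, m ≤ n → e ∈ H.E ∧ e.1 = q (m + 1) ∧ q m ∈ e.2 := by
    intro m
    by_cases hm : m ≤ n
    · obtain ⟨e, h1, h2, h3⟩ := hn m hm
      exact ⟨e, fun _ => ⟨h1, h2, h3⟩⟩
    · exact ⟨(q 0, ∅), fun h => absurd h hm⟩
  choose e he using he
  refine ⟨{ nodes := List.ofFn (fun k : Fin (n + 2) => q (n + 1 - k))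
            edges := List.ofFn (fun k : Fin (n + 1) => e (n - k))
            length_eq := by simp
            edges_ne := by simp
            nodes_nodup := ?_
            edges_nodup := ?_
            edges_mem := ?_
            head_eq := ?_
            tail_mem := ?_ }, ?_, ?_, ?_⟩
  · rw [List.nodup_ofFn]
    intro a b hab
    have := hinj _ (by omega) _ (by omega) hab
    ext; omega
  · rw [List.nodup_ofFn]
    intro a b hab
    have h1 := (he (n - a) (by omega)).2.1
    have h2 := (he (n - b) (by omega)).2.1
    have hab' : e (n - a) = e (n - b) := hab
    rw [hab', h2] at h1
    have := hinj _ (by omega) _ (by omega) h1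
    ext; omega
  · intro x hx
    obtain ⟨k, rfl⟩ := (List.mem_ofFn' _ _).1 hx
    exact (he _ (by omega)).1
  · intro i h
    simp only [List.length_ofFn] at h
    simp only [List.get_eq_getElem, List.getElem_ofFn]
    rw [(he _ (by omega)).2.1]
    congr 1; omega
  · intro i h
    simp only [List.length_ofFn] at h
    simp only [List.get_eq_getElem, List.getElem_ofFn]
    have := (he (n - i) (by omega)).2.2
    convert this using 2; omega
  · simp [HPath.source]
  · simp only [HPath.terminal, List.get_eq_getElem, List.getElem_ofFn, List.length_ofFn]
    congr 1; omega
  · intro x hx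
    obtain ⟨k, rfl⟩ := (List.mem_ofFn' _ _).1 hx
    exact ⟨_, by omega, rfl⟩

theorem aux_menger (f : ℕ) (H : DirHypergraph γ) (U A : Finset γ) (v : γ)
    (hvU : v ∈ U) (hvA : v ∉ A)
    (hS : ∀ S ⊆ U \ A, v ∈ S → f + 1 ≤ (H.inNbrs (U \ S) S).card) :
    ∃ q : Fin (f + 1) → ℕ → γ, ∃ N : Fin (f + 1) → ℕ,
      (∀ i, q i 0 = v ∧ q i (N i + 1) ∈ A) ∧
      (∀ i, ∀ m ≤ N i + 1, q i m ∈ U) ∧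
      (∀ i, ∀ m ≤ N i, H.IsInNbr (q i (m + 1)) (q i m)) ∧
      (∀ i, ∀ a ≤ N i + 1, ∀ b ≤ N i + 1, q i a = q i b → a = b) ∧
      (∀ i j, ∀ a ≤ N i + 1, ∀ b ≤ N j + 1, q i a = q j b → i ≠ j → q i a = v) := by
  let W : Finset γ := (U \ A).erase v
  let t : {w // w ∈ W} ⊕ Fin (f + 1) → Finset γ := fun x => match x with
    | Sum.inl w => insert w.1 ((U.erase v).filter (fun u => H.IsInNbr u w.1))
    | Sum.inr _ => (U.erase v).filter (fun u => H.IsInNbr u v)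
  have hall : ∀ s : Finset ({w // w ∈ W} ⊕ Fin (f + 1)), s.card ≤ (s.biUnion t).card := by
    intro s
    have hs : s.card = s.toLeft.card + s.toRight.card := by
      rw [Finset.card_toLeft_add_card_toRight]
    have hc : (s.toLeft.map (Function.Embedding.subtype _)).card = s.toLeft.card :=
      Finset.card_map _
    set S0 := s.toLeft.map (Function.Embedding.subtype (fun w => w ∈ W)) with hS0
    have hmem : ∀ w, w ∈ S0 ↔ ∃ h : w ∈ W, Sum.inl ⟨w, h⟩ ∈ s := by
      intro w
      simp [hS0]
    have hsub : S0 ⊆ s.biUnion t := by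
      intro w hw
      obtain ⟨h, hw⟩ := (hmem w).1 hw
      exact Finset.mem_biUnion.2 ⟨_, hw, Finset.mem_insert_self _ _⟩
    rcases s.toRight.eq_empty_or_nonempty with h0 | ⟨i, hi⟩
    · rw [hs, h0, Finset.card_empty, add_zero, ← hc]
      exact Finset.card_le_card hsub
    · have hi' : Sum.inr i ∈ s := by simpa using hi
      have hle : s.toRight.card ≤ f + 1 := by
        simpa using Finset.card_le_univ s.toRight
      have hW0 : S0 ⊆ W := fun w hw => ((hmem w).1 hw).1
      have hb := hS (insert v S0) (by
        intro w hw
        rcases Finset.mem_insert.1 hw with rfl | hw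
        · exact Finset.mem_sdiff.2 ⟨hvU, hvA⟩
        · exact Finset.mem_of_mem_erase (hW0 hw)) (Finset.mem_insert_self _ _)
      have hdisj : Disjoint S0 (H.inNbrs (U \ insert v S0) (insert v S0)) := by
        rw [Finset.disjoint_left]
        intro w hw hw'
        have := (Finset.mem_filter.1 hw').1
        exact (Finset.mem_sdiff.1 this).2 (Finset.mem_insert_of_mem hw)
      have hsub2 : S0 ∪ H.inNbrs (U \ insert v S0) (insert v S0) ⊆ s.biUnion t := by
        apply Finset.union_subset hsub
        intro u hu
        obtain ⟨hu1, w, hw, huw⟩ := Finset.mem_filter.1 hu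
        obtain ⟨huU, hu2⟩ := Finset.mem_sdiff.1 hu1
        have huv : u ∈ U.erase v :=
          Finset.mem_erase.2 ⟨fun h => hu2 (h ▸ Finset.mem_insert_self _ _), huU⟩
        rcases Finset.mem_insert.1 hw with rfl | hw
        · exact Finset.mem_biUnion.2 ⟨_, hi', Finset.mem_filter.2 ⟨huv, huw⟩⟩
        · obtain ⟨h, hw⟩ := (hmem w).1 hw
          exact Finset.mem_biUnion.2 ⟨_, hw,
            Finset.mem_insert_of_mem (Finset.mem_filter.2 ⟨huv, huw⟩)⟩
      have := Finset.card_le_card hsub2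
      rw [Finset.card_union_of_disjoint hdisj] at this
      omega
  obtain ⟨g, ginj, hg⟩ := (Finset.all_card_le_biUnion_card_iff_exists_injective t).1 hall
  have hgU : ∀ x, g x ∈ U.erase v := by
    intro x
    have := hg x
    rcases x with w | i
    · rcases Finset.mem_insert.1 this with h | h
      · rw [h]
        have hw := Finset.mem_erase.1 w.2
        exact Finset.mem_erase.2 ⟨hw.1, (Finset.mem_sdiff.1 hw.2).1⟩
      · exact (Finset.mem_filter.1 h).1
    · exact (Finset.mem_filter.1 this).1
  let h : γ → γ := fun w => if hw : w ∈ W then g (Sum.inl ⟨w, hw⟩) else w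
  let p : Fin (f + 1) → ℕ → γ := fun i n => h^[n] (g (Sum.inr i))
  have p0 : ∀ i, p i 0 = g (Sum.inr i) := fun i => rfl
  have ps : ∀ i n, p i (n + 1) = h (p i n) := fun i n => Function.iterate_succ_apply' _ _ _
  have pU : ∀ i n, p i n ∈ U.erase v := by
    intro i n
    induction n with
    | zero => exact hgU _
    | succ k ih =>
      rw [ps]
      by_cases hw : p i k ∈ W
      · simp only [h, dif_pos hw]; exact hgU _
      · simp only [h, dif_neg hw]; exact ih
  have pW : ∀ i n, p i n ∉ A → p i n ∈ W := by
    intro i n hA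
    have := Finset.mem_erase.1 (pU i n)
    exact Finset.mem_erase.2 ⟨this.1, Finset.mem_sdiff.2 ⟨this.2, hA⟩⟩
  have pg : ∀ i n (hA : p i n ∉ A), p i (n + 1) = g (Sum.inl ⟨p i n, pW i n hA⟩) := by
    intro i n hA
    rw [ps]
    simp only [h, dif_pos (pW i n hA)]
  have main : ∀ m n i j, (∀ m' < m, p i m' ∉ A) → (∀ n' < n, p j n' ∉ A) →
      p i m = p j n → i = j ∧ m = n := by
    intro m
    induction m with
    | zero =>
      intro n i j _ h2 he
      cases n with
      | zero =>
        have := ginj he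
        exact ⟨Sum.inr_injective this, rfl⟩
      | succ n =>
        rw [pg j n (h2 n (by omega))] at he
        have := ginj he
        simp at this
    | succ m ih =>
      intro n i j h1 h2 he
      rw [pg i m (h1 m (by omega))] at he
      cases n with
      | zero =>
        have := ginj he
        simp at this
      | succ n =>
        rw [pg j n (h2 n (by omega))] at he
        have := Sum.inl_injective (ginj he)
        have := ih n i j (fun m' hm => h1 m' (by omega)) (fun n' hn => h2 n' (by omega))
          (Subtype.ext_iff.1 this)
        exact ⟨this.1, by omega⟩
  have hex : ∀ i, ∃ n, p i n ∈ A := by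
    intro i
    by_contra hcon
    push Not at hcon
    have hi : Function.Injective (fun n => (⟨p i n, pU i n⟩ : {x // x ∈ U.erase v})) := by
      intro a b hab
      exact (main a b i i (fun _ _ => hcon _) (fun _ _ => hcon _) (Subtype.ext_iff.1 hab)).2
    exact not_injective_infinite_finite _ hi
  let N : Fin (f + 1) → ℕ := fun i => Nat.find (hex i)
  have hN : ∀ i, p i (N i) ∈ A := fun i => Nat.find_spec (hex i)
  have hN' : ∀ i, ∀ m < N i, p i m ∉ A := fun i m hm => Nat.find_min (hex i) hm
  let q : Fin (f + 1) → ℕ → γ := fun i n => match n with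
    | 0 => v
    | n + 1 => p i n
  have hpv : ∀ i n, p i n ≠ v := fun i n => (Finset.mem_erase.1 (pU i n)).1
  refine ⟨q, N, fun i => ⟨rfl, hN i⟩, ?_, ?_, ?_, ?_⟩
  · intro i m _
    cases m with
    | zero => exact hvU
    | succ m => exact Finset.mem_of_mem_erase (pU i m)
  · intro i m hm
    cases m with
    | zero => exact (Finset.mem_filter.1 (hg (Sum.inr i))).2
    | succ m =>
      change H.IsInNbr (p i (m + 1)) (p i m)
      have hA := hN' i m (by omega)
      have := hg (Sum.inl ⟨p i m, pW i m hA⟩)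
      rw [← pg i m hA] at this
      rcases Finset.mem_insert.1 this with h | h
      · have := main (m + 1) m i i (fun m' hm' => hN' i m' (by omega))
          (fun m' hm' => hN' i m' (by omega)) h
        omega
      · exact (Finset.mem_filter.1 h).2
  · intro i a ha b hb hab
    cases a with
    | zero =>
      cases b with
      | zero => rfl
      | succ b => exact absurd hab.symm (hpv i b)
    | succ a =>
      cases b with
      | zero => exact absurd hab (hpv i a)
      | succ b =>
        have := (main a b i i (fun m' hm' => hN' i m' (by omega))
          (fun m' hm' => hN' i m' (by omega)) hab).2
        omega
  · intro i j a ha b hb hab hij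
    cases a with
    | zero => rfl
    | succ a =>
      cases b with
      | zero => exact hab
      | succ b =>
        exact absurd (main a b i j (fun m' hm' => hN' i m' (by omega))
          (fun m' hm' => hN' j m' (by omega)) hab).1 hij

/-- If propagation fails there is a bad set. -/
theorem aux_not_prop (f : ℕ) (H : DirHypergraph γ) (A B K : Finset γ)
    (hd : Disjoint A B) (hV : A ∪ B = H.V)
    (hP : ¬ Propagates f (H.remove (B ∩ K)) A (B \ K)) :
    ∃ S ⊆ B \ K, S.Nonempty ∧ ¬ (f + 1 ≤ (H.inNbrs ((H.V \ (B ∩ K)) \ S) S).card) := by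
  by_contra hcon
  push Not at hcon
  apply hP
  right
  intro v hv
  obtain ⟨hvB, hvK⟩ := Finset.mem_sdiff.1 hv
  have hsd : (H.V \ (B ∩ K)) \ A = B \ K := by
    ext x
    have : x ∈ A → x ∉ B := fun hx => Finset.disjoint_left.1 hd hx
    simp only [← hV, Finset.mem_sdiff, Finset.mem_union, Finset.mem_inter]
    tauto
  have hvU : v ∈ H.V \ (B ∩ K) := by
    simp only [← hV, Finset.mem_sdiff, Finset.mem_union, Finset.mem_inter]
    tauto
  obtain ⟨q, N, h1, h2, h3, h4, h5⟩ := aux_menger f H (H.V \ (B ∩ K)) A v hvU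
    (Finset.disjoint_right.1 hd hvB)
    (fun S hS hvS => hcon S (hsd ▸ hS) ⟨v, hvS⟩)
  have := fun i => aux_path (H.remove (B ∩ K)) (q i) (N i) (h4 i) (fun m hm =>
    (aux_nbr_remove _ _ _ _).2 ⟨h2 i _ (by omega), h2 i _ (by omega), h3 i m hm⟩)
  choose P hs ht hn using this
  refine ⟨P, fun i => ⟨by rw [hs]; exact (h1 i).2, by rw [ht]; exact (h1 i).1⟩, ?_⟩
  intro i j hij x hx hx'
  obtain ⟨a, ha, rfl⟩ := hn i x hx
  obtain ⟨b, hb, hab⟩ := hn j _ hx'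
  exact h5 i j a ha b hb hab hij

set_option maxHeartbeats 1000000 in
theorem aux_equiv (f : ℕ) (H : DirHypergraph γ) (K : Finset γ) :
    (∀ L C R : Finset γ, Partition3 L C R H.V →
      Adjacent f H (L ∪ C) (R \ K) ∨ Adjacent f H (R ∪ C) (L \ K)) ↔
    (∀ A B : Finset γ, Disjoint A B → A ∪ B = H.V →
      Propagates f (H.remove (B ∩ K)) A (B \ K) ∨
      Propagates f (H.remove (A ∩ K)) B (A \ K)) := by
  constructor
  · intro h A B hd hV
    by_contra hcon
    push Not at hcon
    obtain ⟨S, hSB, hSn, hS⟩ := aux_not_prop f H A B K hd hV hcon.1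
    obtain ⟨T, hTA, hTn, hT⟩ := aux_not_prop f H B A K hd.symm (by rw [Finset.union_comm, hV])
      hcon.2
    have hd' : ∀ x, x ∈ A → x ∉ B := fun x hx => Finset.disjoint_left.1 hd hx
    have hSB' : ∀ x, x ∈ S → x ∈ B ∧ x ∉ K := fun x hx => Finset.mem_sdiff.1 (hSB hx)
    have hTA' : ∀ x, x ∈ T → x ∈ A ∧ x ∉ K := fun x hx => Finset.mem_sdiff.1 (hTA hx)
    have hV' : ∀ x, x ∈ H.V ↔ x ∈ A ∨ x ∈ B := fun x => by rw [← hV, Finset.mem_union]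
    have e1 : (S ∪ (B ∩ K)) \ K = S := by
      ext x
      have := hSB' x
      simp only [Finset.mem_sdiff, Finset.mem_union, Finset.mem_inter]
      grind
    have e2 : (T ∪ (A ∩ K)) \ K = T := by
      ext x
      have := hTA' x
      simp only [Finset.mem_sdiff, Finset.mem_union, Finset.mem_inter]
      grind
    have := h (T ∪ (A ∩ K)) (H.V \ ((T ∪ (A ∩ K)) ∪ (S ∪ (B ∩ K)))) (S ∪ (B ∩ K)) (by
      refine ⟨?_, ?_, ?_, ?_⟩
      · rw [Finset.disjoint_left]; intro x
        simp only [Finset.mem_sdiff, Finset.mem_union, Finset.mem_inter]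
        grind
      · rw [Finset.disjoint_left]; intro x
        have := hd' x; have := hSB' x; have := hTA' x
        simp only [Finset.mem_union, Finset.mem_inter]
        grind
      · rw [Finset.disjoint_left]; intro x
        simp only [Finset.mem_sdiff, Finset.mem_union, Finset.mem_inter]
        grind
      · ext x
        have := hV' x; have := hSB' x; have := hTA' x
        simp only [Finset.mem_sdiff, Finset.mem_union, Finset.mem_inter]
        grind)
    rw [e1, e2] at this
    rcases this with (h0 | h1) | (h0 | h1)
    · exact hSn.ne_empty h0
    · apply hS
      refine h1.trans (Finset.card_le_card (Finset.filter_subset_filter _ ?_))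
      intro x
      have := hV' x; have := hSB' x; have := hTA' x; have := hd' x
      simp only [Finset.mem_sdiff, Finset.mem_union, Finset.mem_inter]
      grind
    · exact hTn.ne_empty h0
    · apply hT
      refine h1.trans (Finset.card_le_card (Finset.filter_subset_filter _ ?_))
      intro x
      have := hV' x; have := hSB' x; have := hTA' x; have := hd' x
      simp only [Finset.mem_sdiff, Finset.mem_union, Finset.mem_inter]
      grind
  · intro h L C R ⟨hLC, hLR, hCR, hV⟩
    have d1 : ∀ x, x ∈ L → x ∉ C := fun x hx => Finset.disjoint_left.1 hLC hx
    have d2 : ∀ x, x ∈ L → x ∉ R := fun x hx => Finset.disjoint_left.1 hLR hx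
    have d3 : ∀ x, x ∈ C → x ∉ R := fun x hx => Finset.disjoint_left.1 hCR hx
    by_cases hR : R \ K = ∅
    · exact Or.inl (Or.inl hR)
    by_cases hL : L \ K = ∅
    · exact Or.inr (Or.inl hL)
    obtain ⟨r, hr⟩ := Finset.nonempty_iff_ne_empty.2 hR
    obtain ⟨l, hl⟩ := Finset.nonempty_iff_ne_empty.2 hL
    rcases h (L ∪ C) R (Finset.disjoint_union_left.2 ⟨hLR, hCR⟩) hV with hP | hP
    · left; right
      refine aux_prop_adj f H _ _ _ (R \ K) (L ∪ C) r hP hr hr ?_ ?_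
      · rw [Finset.disjoint_left]; intro x
        have h2 := d2 x; have h3 := d3 x
        simp only [Finset.mem_sdiff, Finset.mem_union]
        grind
      · intro x
        simp only [← hV, Finset.mem_sdiff, Finset.mem_union, Finset.mem_inter]
        grind
    · right; right
      refine aux_prop_adj f H _ _ _ (L \ K) (R ∪ C) l hP ?_ hl ?_ ?_
      · rw [Finset.mem_sdiff] at hl ⊢
        exact ⟨Finset.mem_union_left _ hl.1, hl.2⟩
      · rw [Finset.disjoint_left]; intro x
        have := d2 x
        simp only [Finset.mem_sdiff]
        grind
      · intro x
        simp only [← hV, Finset.mem_sdiff, Finset.mem_union, Finset.mem_inter]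
        grind

end Aux

end DirHypergraph

/-- A directed hypergraph satisfies condition LCR-hyper iff it
satisfies condition AB-hyper. -/
theorem stmt_5 {α : Type} [DecidableEq α] (f : ℕ) (G : DirHypergraph α)
    (hvalid : G.IsValid) :
    G.CondLCRHyper f ↔ G.CondABHyper f := by
  unfold DirHypergraph.CondLCRHyper DirHypergraph.CondABHyper
    DirHypergraph.CondLCRHyperWith DirHypergraph.CondABHyperWith
  constructor
  · intro h F hF hf G' hG'
    exact (DirHypergraph.aux_equiv f G' (G'.corr F)).1 (h F hF hf G' hG')
  · intro h F hF hf G' hG'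
    exact (DirHypergraph.aux_equiv f G' (G'.corr F)).2 (h F hF hf G' hG')
end
end

section
/- Let G = (V, E) be a directed hypergraph satisfying condition AB-hyper, let F ⊆ V with |F| ≤ f, and let S be the unique source component of the directed decomposition of G − F. Then the induced sub-hypergraph G[S ∪ N_G(F, S)] satisfies condition AB-hyper with parameter N_G(F, S), where N_G(F, S) is the set of nodes of F that are in-neighbors in G of some node of S. -/
open scoped Classical

noncomputable section

variable {α : Type} [DecidableEq α]

namespace DirHypergraph

theorem HPath.chain {γ : Type} [DecidableEq γ] {K : DirHypergraph γ} (P : HPath K) :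
    P.nodes.IsChain K.IsInNbr := by
  rw [List.isChain_iff_getElem]
  intro i hi
  have hl := P.length_eq
  have h : i < P.edges.length := by omega
  refine ⟨P.edges.get ⟨i, h⟩, P.edges_mem _ (List.get_mem _ _), ?_, ?_⟩
  · simpa using P.head_eq i h
  · simpa using P.tail_mem i h

theorem exists_hpath {γ : Type} [DecidableEq γ] {K : DirHypergraph γ} (l : List γ)
    (hlen : 2 ≤ l.length) (hnd : l.Nodup) (hc : l.IsChain K.IsInNbr) :
    ∃ P : HPath K, P.nodes = l := by
  rw [List.isChain_iff_getElem] at hc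
  choose g hg1 hg2 hg3 using hc
  let es : List (γ × Finset γ) :=
    List.ofFn (fun i : Fin (l.length - 1) => g i.1 (by omega))
  refine ⟨⟨l, es, ?_, ?_, hnd, ?_, ?_, ?_, ?_⟩, rfl⟩
  · simp [es]; omega
  · intro h
    have : es.length = 0 := by rw [h]; rfl
    simp [es] at this; omega
  · rw [List.nodup_ofFn]
    intro i j hij
    have h1 := hg2 i.1 (by omega)
    have h2 := hg2 j.1 (by omega)
    simp only at hij
    rw [hij, h2] at h1
    have := (List.Nodup.getElem_inj_iff hnd).1 h1
    exact Fin.ext this.symm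
  · intro e he
    simp only [es, List.mem_ofFn] at he
    obtain ⟨i, rfl⟩ := he
    exact hg1 _ _
  · intro i h
    simp [es, hg2]
  · intro i h
    simp only [List.get_eq_getElem, es, List.getElem_ofFn]
    exact hg3 _ _

theorem suffix_aux {γ : Type} (R1 R2 : γ → γ → Prop) (A T : Set γ)
    (h2 : ∀ u w, R1 u w → w ∈ T → (u ∈ A ∨ u ∈ T) ∧ R2 u w) (v : γ) (hv : v ∈ T) :
    ∀ l : List γ, l.IsChain R1 → l.getLast? = some v →
      ((∀ x ∈ l, x ∈ T) ∧ l.IsChain R2) ∨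
      ∃ l', l' <:+ l ∧ 2 ≤ l'.length ∧ l'.IsChain R2 ∧ (∃ a ∈ A, l'.head? = some a) ∧
        l'.getLast? = some v := by
  intro l
  induction l with
  | nil => intro _ h; simp at h
  | cons a l ih =>
    intro hc hl
    cases l with
    | nil =>
      left
      simp at hl
      subst hl
      simp [hv]
    | cons b l =>
      rw [List.isChain_cons_cons] at hc
      rw [List.getLast?_cons_cons] at hl
      rcases ih hc.2 hl with ⟨hT, hc2⟩ | ⟨l', h1, h3⟩
      · have hb := h2 a b hc.1 (hT b (by simp))
        have hcc : (a :: b :: l).IsChain R2 := List.isChain_cons_cons.2 ⟨hb.2, hc2⟩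
        rcases hb.1 with ha | ha
        · right
          exact ⟨a :: b :: l, List.suffix_refl _, by simp, hcc, ⟨a, ha, rfl⟩,
            by rw [List.getLast?_cons_cons]; exact hl⟩
        · left
          refine ⟨?_, hcc⟩
          intro x hx
          rcases List.mem_cons.1 hx with rfl | hx
          · exact ha
          · exact hT x hx
      · right
        exact ⟨l', h1.trans (List.suffix_cons _ _), h3⟩

theorem HPath.source_head {γ : Type} [DecidableEq γ] {K : DirHypergraph γ} (P : HPath K) :
    P.nodes.head? = some P.source := by
  have := P.length_eq
  rw [List.head?_eq_getElem?, List.getElem?_eq_getElem (by omega)]; rfl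

theorem HPath.terminal_last {γ : Type} [DecidableEq γ] {K : DirHypergraph γ} (P : HPath K) :
    P.nodes.getLast? = some P.terminal := by
  have := P.length_eq
  rw [List.getLast?_eq_getElem?, List.getElem?_eq_getElem (by omega)]; rfl

theorem propagates_transfer {γ : Type} [DecidableEq γ] (f : ℕ) (K1 K2 : DirHypergraph γ)
    (A1 A2 T1 T : Finset γ) (hT : T ⊆ T1) (hd : ∀ x ∈ A1, x ∉ T)
    (h2 : ∀ u w, K1.IsInNbr u w → w ∈ T → (u ∈ A2 ∨ u ∈ T) ∧ K2.IsInNbr u w)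
    (h : Propagates f K1 A1 T1) : Propagates f K2 A2 T := by
  right
  intro v hv
  rcases h with h | h
  · rw [h] at hT; exact absurd (hT hv) (by simp)
  obtain ⟨P, hP, hdis⟩ := h v (hT hv)
  have key : ∀ i, ∃ Q : HPath K2, Q.nodes ⊆ (P i).nodes ∧ Q.source ∈ A2 ∧ Q.terminal = v := by
    intro i
    have hlast := (P i).terminal_last
    rw [(hP i).2] at hlast
    have := suffix_aux K1.IsInNbr K2.IsInNbr (A2 : Set γ) (T : Set γ)
      (by intro u w; simpa using h2 u w) v (by simpa using hv) (P i).nodes (P i).chain hlast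
    rcases this with ⟨hall, -⟩ | ⟨l', hs, hlen, hc, ⟨a, ha, hh⟩, hl⟩
    · exfalso
      have hm : (P i).source ∈ (P i).nodes := List.get_mem _ _
      exact hd _ (hP i).1 (by simpa using hall _ hm)
    · obtain ⟨Q, hQ⟩ := exists_hpath l' hlen ((P i).nodes_nodup.sublist hs.sublist) hc
      refine ⟨Q, ?_, ?_, ?_⟩
      · rw [hQ]; exact hs.subset
      · have := Q.source_head
        rw [hQ, hh] at this
        rw [← Option.some.inj this]; simpa using ha
      · have := Q.terminal_last
        rw [hQ, hl] at this
        exact (Option.some.inj this).symm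
  choose Q hQ1 hQ2 hQ3 using key
  exact ⟨Q, fun i => ⟨hQ2 i, hQ3 i⟩,
    fun i j hij x hx hy => hdis i j hij x (hQ1 i hx) (hQ1 j hy)⟩

theorem mem_splitSet {α : Type} [DecidableEq α] (X W : Finset α) (x : SplitNode α) :
    x ∈ splitSet X W ↔ x.base ∈ W ∧ x ∈ splitCopies X x.base := by
  have hb : ∀ v, x ∈ splitCopies X v → x.base = v := by
    intro v hv
    unfold splitCopies at hv
    split_ifs at hv
    · simp at hv; rcases hv with rfl | rfl <;> rfl
    · simp at hv; subst hv; rfl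
  unfold splitSet
  rw [Finset.mem_biUnion]
  constructor
  · rintro ⟨v, hv, hx⟩
    have := hb v hx
    subst this
    exact ⟨hv, hx⟩
  · rintro ⟨h1, h2⟩
    exact ⟨_, h1, h2⟩

theorem induced_inNbr {γ : Type} [DecidableEq γ] (K : DirHypergraph γ) (U : Finset γ) (u w : γ) :
    (K.induced U).IsInNbr u w ↔ K.IsInNbr u w ∧ u ∈ U ∧ w ∈ U := by
  unfold IsInNbr induced
  constructor
  · rintro ⟨e, he, rfl, hw⟩
    simp only [Finset.mem_filter, Finset.mem_image] at he
    obtain ⟨⟨e', ⟨h1, h2⟩, rfl⟩, -⟩ := he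
    simp only [Finset.mem_inter] at hw
    exact ⟨⟨e', h1, rfl, hw.1⟩, h2, hw.2⟩
  · rintro ⟨⟨e, he, rfl, hw⟩, hu, hwU⟩
    refine ⟨(e.1, e.2 ∩ U), ?_, rfl, by simp [hw, hwU]⟩
    simp only [Finset.mem_filter, Finset.mem_image]
    exact ⟨⟨e, ⟨he, hu⟩, rfl⟩, ⟨w, by simp [hw, hwU]⟩⟩

theorem key_step {α : Type} [DecidableEq α] (G : DirHypergraph α)
    (hvalid : G.IsValid) (F S X : Finset α) (hS : (G.remove F).IsSourceComponent S)
    (a : α × Finset α → Bool) (U : Finset α) (hU : U = S ∪ G.inNbrs F S)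
    (H' G' : DirHypergraph (SplitNode α))
    (hH : H' = (G.induced U).splitGraph X a)
    (hG : G' = G.splitGraph X (fun e => a (e.1, e.2 ∩ U)))
    (A B B₂ : Finset (SplitNode α)) (hAB : A ∪ B = H'.V) (hB : B ⊆ B₂)
    (u w : SplitNode α)
    (h : (G'.remove (B₂ ∩ G'.corr F)).IsInNbr u w) (hw : w ∈ B \ H'.corr (G.inNbrs F S)) :
    (u ∈ A ∨ u ∈ B \ H'.corr (G.inNbrs F S)) ∧
      (H'.remove (B ∩ H'.corr (G.inNbrs F S))).IsInNbr u w := by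
  have hSV : S ⊆ G.V \ F := hS.1.2.1
  have hHV : H'.V = splitSet X U := by rw [hH]; rfl
  have hGV : G'.V = splitSet X G.V := by rw [hG]; rfl
  unfold remove at h ⊢
  rw [induced_inNbr] at h ⊢
  obtain ⟨⟨e', he', rfl, hwe⟩, hu, hw2⟩ := h
  rw [Finset.mem_sdiff] at hw
  obtain ⟨hwB, hwc⟩ := hw
  have hwH : w ∈ H'.V := by rw [← hAB]; exact Finset.mem_union_right _ hwB
  have hwU : w.base ∈ U := by rw [hHV, mem_splitSet] at hwH; exact hwH.1
  have hwS : w.base ∈ S := by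
    rw [hU, Finset.mem_union] at hwU
    rcases hwU with h | h
    · exact h
    · exact absurd (by simp only [corr, Finset.mem_filter]; exact ⟨hwH, h⟩) hwc
  have hE : G'.E = G.E.image (fun e =>
    ((if e.1 ∈ X then Sum.inr (e.1, a (e.1, e.2 ∩ U)) else Sum.inl e.1 : SplitNode α),
      splitSet X e.2)) := by rw [hG]; rfl
  rw [hE, Finset.mem_image] at he'
  obtain ⟨e, he, rfl⟩ := he'
  simp only at hwe hu ⊢
  set u : SplitNode α :=
    (if e.1 ∈ X then Sum.inr (e.1, a (e.1, e.2 ∩ U)) else Sum.inl e.1 : SplitNode α) with hudef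
  have hub : u.base = e.1 := by rw [hudef]; split_ifs <;> rfl
  rw [mem_splitSet] at hwe
  have hnb : G.IsInNbr e.1 w.base := ⟨e, he, rfl, hwe.1⟩
  have heU : e.1 ∈ U := by
    rw [hU, Finset.mem_union]
    by_cases hF : e.1 ∈ F
    · right
      simp only [inNbrs, Finset.mem_filter]
      exact ⟨hF, _, hwS, hnb⟩
    · left
      by_contra hn
      have hV : e.1 ∈ G.V \ F := Finset.mem_sdiff.2 ⟨(hvalid e he).1, hF⟩
      refine hS.2 e.1 hV hn w.base hwS ?_
      unfold remove
      rw [induced_inNbr]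
      exact ⟨hnb, hV, hSV hwS⟩
  rw [Finset.mem_sdiff] at hu
  have huH : u ∈ H'.V := by
    rw [hHV, mem_splitSet]
    rw [hGV, mem_splitSet] at hu
    exact ⟨hub ▸ heU, hu.1.2⟩
  have hux : ¬ (u ∈ B ∧ u ∈ H'.corr (G.inNbrs F S)) := by
    rintro ⟨h1, h2⟩
    apply hu.2
    simp only [corr, inNbrs, Finset.mem_inter, Finset.mem_filter] at h2 ⊢
    exact ⟨hB h1, hu.1, h2.2.1⟩
  refine ⟨?_, ?_, ?_, ?_⟩
  · have := huH
    rw [← hAB, Finset.mem_union] at this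
    rcases this with h | h
    · exact Or.inl h
    · exact Or.inr (Finset.mem_sdiff.2 ⟨h, fun h' => hux ⟨h, h'⟩⟩)
  · refine ⟨(u, splitSet X (e.2 ∩ U)), ?_, rfl, ?_⟩
    · rw [hH]
      refine Finset.mem_image.2 ⟨(e.1, e.2 ∩ U), ?_, rfl⟩
      simp only [induced, Finset.mem_filter, Finset.mem_image]
      exact ⟨⟨e, ⟨he, heU⟩, rfl⟩, w.base, Finset.mem_inter.2 ⟨hwe.1, hwU⟩⟩
    · rw [mem_splitSet]
      exact ⟨Finset.mem_inter.2 ⟨hwe.1, hwU⟩, hwe.2⟩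
  · rw [Finset.mem_sdiff, Finset.mem_inter]
    exact ⟨huH, hux⟩
  · rw [Finset.mem_sdiff, Finset.mem_inter]
    exact ⟨hwH, fun h => hwc h.2⟩

end DirHypergraph


/-- If `G` satisfies condition AB-hyper, `F ⊆ V` with `|F| ≤ f`, and
`S` is the unique source component of `G − F`, then `G[S ∪ N_G(F, S)]` satisfies
condition AB-hyper with parameter `N_G(F, S)`. -/
theorem stmt_7 {α : Type} [DecidableEq α] (f : ℕ) (G : DirHypergraph α)
    (hvalid : G.IsValid) (hAB : G.CondABHyper f)
    (F : Finset α) (hF : F ⊆ G.V) (hFcard : F.card ≤ f)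
    (S : Finset α) (hS : (G.remove F).IsSourceComponent S)
    (huniq : ∀ S' : Finset α, (G.remove F).IsSourceComponent S' → S' = S) :
    DirHypergraph.CondABHyperWith f (G.induced (S ∪ G.inNbrs F S)) (G.inNbrs F S) := by
  rintro H' ⟨X, hX, a, hH⟩ A B hdisj hAB'
  have hSV : S ⊆ G.V \ F := hS.1.2.1
  have hNF : G.inNbrs F S ⊆ F := Finset.filter_subset _ _
  obtain ⟨U, hU⟩ : ∃ U, U = S ∪ G.inNbrs F S := ⟨_, rfl⟩
  rw [← hU] at hH
  obtain ⟨G', hG⟩ : ∃ G', G' = G.splitGraph X (fun e => a (e.1, e.2 ∩ U)) := ⟨_, rfl⟩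
  have hHV : H'.V = DirHypergraph.splitSet X U := by rw [hH]; rfl
  have hGV : G'.V = DirHypergraph.splitSet X G.V := by rw [hG]; rfl
  have hUV : U ⊆ G.V := by
    rw [hU]
    exact Finset.union_subset (hSV.trans Finset.sdiff_subset) (hNF.trans hF)
  have hVV : H'.V ⊆ G'.V := by
    intro x hx
    rw [hHV, DirHypergraph.mem_splitSet] at hx
    rw [hGV, DirHypergraph.mem_splitSet]
    exact ⟨hUV hx.1, hx.2⟩
  have hAH : A ⊆ H'.V := hAB' ▸ Finset.subset_union_left
  have hBH : B ⊆ H'.V := hAB' ▸ Finset.subset_union_right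
  have hsub : ∀ x ∈ H'.V, x ∉ H'.corr (G.inNbrs F S) → x ∉ G'.corr F := by
    intro x hx hn hc
    simp only [DirHypergraph.corr, Finset.mem_filter] at hn hc
    have hxU : x.base ∈ U := by
      rw [hHV, DirHypergraph.mem_splitSet] at hx; exact hx.1
    rw [hU, Finset.mem_union] at hxU
    rcases hxU with h | h
    · exact (Finset.mem_sdiff.1 (hSV h)).2 hc.2
    · exact hn ⟨hx, h⟩
  have hmain := hAB F hF hFcard G' ⟨X, hX.trans hNF, _, hG⟩ (A ∪ (G'.V \ H'.V)) B
    (by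
      rw [Finset.disjoint_union_left]
      refine ⟨hdisj, ?_⟩
      rw [Finset.disjoint_left]
      intro x hx hxB
      exact (Finset.mem_sdiff.1 hx).2 (hBH hxB))
    (by
      rw [Finset.union_right_comm, hAB', Finset.union_sdiff_of_subset hVV])
  rcases hmain with h | h
  · left
    refine DirHypergraph.propagates_transfer f _ _ _ A _ _ ?_ ?_ ?_ h
    · intro x hx
      rw [Finset.mem_sdiff] at hx ⊢
      exact ⟨hx.1, hsub x (hBH hx.1) hx.2⟩
    · intro x hx hxB
      rw [Finset.mem_sdiff] at hxB
      rcases Finset.mem_union.1 hx with h | h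
      · exact Finset.disjoint_left.1 hdisj h hxB.1
      · exact (Finset.mem_sdiff.1 h).2 (hBH hxB.1)
    · intro u w huw hw
      exact DirHypergraph.key_step G hvalid F S X hS a U hU H' G' hH hG A B B hAB'
        (Finset.Subset.refl _) u w huw hw
  · right
    refine DirHypergraph.propagates_transfer f _ _ _ B _ _ ?_ ?_ ?_ h
    · intro x hx
      rw [Finset.mem_sdiff] at hx ⊢
      exact ⟨Finset.mem_union_left _ hx.1, hsub x (hAH hx.1) hx.2⟩
    · intro x hx hxA
      exact Finset.disjoint_left.1 hdisj (Finset.mem_sdiff.1 hxA).1 hx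
    · intro u w huw hw
      exact DirHypergraph.key_step G hvalid F S X hS a U hU H' G' hH hG B A _
        (by rw [Finset.union_comm]; exact hAB') Finset.subset_union_left u w huw hw
end
end

section
/- Let G = (V, E) be a directed hypergraph satisfying condition AB-hyper, let F ⊆ V with |F| ≤ f, and let S be the unique source component of the directed decomposition of G − F. Then S propagates to V \ S \ F in G − F, i.e., S ⇒_{G − F} V \ S \ F. -/
open scoped Classical

noncomputable section

variable {α : Type} [DecidableEq α]

namespace DirHypergraph

theorem isInNbr_induced {β : Type} [DecidableEq β] (G : DirHypergraph β) (U : Finset β) (u v : β) :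
    (G.induced U).IsInNbr u v ↔ G.IsInNbr u v ∧ u ∈ U ∧ v ∈ U := by
  constructor
  · rintro ⟨e, he, rfl, hv⟩
    simp only [induced, Finset.mem_filter, Finset.mem_image] at he
    obtain ⟨⟨e', ⟨he', hu⟩, rfl⟩, -⟩ := he
    simp only [Finset.mem_inter] at hv
    exact ⟨⟨e', he', rfl, hv.1⟩, hu, hv.2⟩
  · rintro ⟨⟨e, he, rfl, hv⟩, hu, hvU⟩
    have hm : v ∈ e.2 ∩ U := Finset.mem_inter.2 ⟨hv, hvU⟩
    refine ⟨(e.1, e.2 ∩ U), ?_, rfl, hm⟩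
    simp only [induced, Finset.mem_filter, Finset.mem_image]
    exact ⟨⟨e, ⟨he, hu⟩, rfl⟩, ⟨v, hm⟩⟩

theorem mem_splitSet_s8 {β : Type} [DecidableEq β] (X T : Finset β) (y : SplitNode β) :
    y ∈ splitSet X T ↔ (∃ v ∈ T, v ∉ X ∧ y = Sum.inl v) ∨
      (∃ v ∈ T, v ∈ X ∧ ∃ b, y = Sum.inr (v, b)) := by
  simp only [splitSet, Finset.mem_biUnion, splitCopies]
  constructor
  · rintro ⟨v, hv, h⟩
    split_ifs at h with hX
    · right
      simp only [Finset.mem_insert, Finset.mem_singleton] at h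
      rcases h with h | h <;> exact ⟨v, hv, hX, _, h⟩
    · left
      simp only [Finset.mem_singleton] at h
      exact ⟨v, hv, hX, h⟩
  · rintro (⟨v, hv, hX, rfl⟩ | ⟨v, hv, hX, b, rfl⟩)
    · exact ⟨v, hv, by simp [hX]⟩
    · exact ⟨v, hv, by cases b <;> simp [hX]⟩

theorem split_inNbr {β : Type} [DecidableEq β] (G : DirHypergraph β) (F : Finset β)
    (x y : SplitNode β) (h : (G.splitGraph F (fun _ => true)).IsInNbr x y) :
    G.IsInNbr x.base y.base ∧ ((x = Sum.inl x.base ∧ x.base ∉ F) ∨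
      (x = Sum.inr (x.base, true) ∧ x.base ∈ F)) := by
  obtain ⟨e', he', rfl, hy⟩ := h
  simp only [splitGraph, Finset.mem_image] at he'
  obtain ⟨e, he, rfl⟩ := he'
  have hyb : y.base ∈ e.2 := by
    rcases (mem_splitSet_s8 _ _ _).1 hy with ⟨v, hv, -, rfl⟩ | ⟨v, hv, -, b, rfl⟩ <;> exact hv
  by_cases hX : e.1 ∈ F
  · simp only [hX, if_true]
    exact ⟨⟨e, he, rfl, hyb⟩, Or.inr ⟨rfl, hX⟩⟩
  · simp only [hX, if_false]
    exact ⟨⟨e, he, rfl, hyb⟩, Or.inl ⟨rfl, hX⟩⟩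

theorem HPath.step {β : Type} [DecidableEq β] {G : DirHypergraph β} (P : HPath G) (i : ℕ)
    (h : i + 1 < P.nodes.length) : G.IsInNbr P.nodes[i] P.nodes[i+1] := by
  have h' : i < P.edges.length := by have := P.length_eq; omega
  exact ⟨P.edges.get ⟨i, h'⟩, P.edges_mem _ (List.get_mem _ _), P.head_eq i h', P.tail_mem i h'⟩

theorem exists_path {β : Type} [DecidableEq β] (G : DirHypergraph β) (l : List β)
    (hn : l.Nodup) (hl : 2 ≤ l.length)
    (hs : ∀ (i : ℕ) (h : i + 1 < l.length), G.IsInNbr l[i] l[i+1]) :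
    ∃ P : HPath G, P.nodes = l := by
  choose e he h1 h2 using hs
  refine ⟨{ nodes := l
            edges := List.ofFn (n := l.length - 1) (fun i => e i.1 (by omega))
            length_eq := by simp; omega
            edges_ne := by
              intro h
              have := congrArg List.length h
              simp at this
              omega
            nodes_nodup := hn
            edges_nodup := ?_
            edges_mem := ?_
            head_eq := ?_
            tail_mem := ?_ }, rfl⟩
  · rw [List.nodup_ofFn]
    intro i j hij
    have := congrArg Prod.fst hij
    simp only [h1] at this
    have := (hn.getElem_inj_iff).1 this
    exact Fin.ext this
  · intro x hx
    rw [List.mem_ofFn] at hx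
    obtain ⟨i, rfl⟩ := hx
    exact he _ _
  · intro i h
    simp [h1]
  · intro i h
    simp only [List.get_eq_getElem, List.getElem_ofFn]
    exact h2 _ _

end DirHypergraph

/-- If `G` satisfies condition AB-hyper, `F ⊆ V` with `|F| ≤ f`, and
`S` is the unique source component of `G − F`, then `S ⇒_{G − F} V \ S \ F`. -/
theorem stmt_8 {α : Type} [DecidableEq α] (f : ℕ) (G : DirHypergraph α)
    (hvalid : G.IsValid) (hAB : G.CondABHyper f)
    (F : Finset α) (hF : F ⊆ G.V) (hFcard : F.card ≤ f)
    (S : Finset α) (hS : (G.remove F).IsSourceComponent S)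
    (huniq : ∀ S' : Finset α, (G.remove F).IsSourceComponent S' → S' = S) :
    DirHypergraph.Propagates f (G.remove F) S ((G.V \ S) \ F) := by
  set G' := G.splitGraph F (fun _ => true) with hG'
  set A : Finset (SplitNode α) := G'.V.filter
    (fun x => (∃ s ∈ S, x = Sum.inl s) ∨ ∃ u, x = Sum.inr (u, false)) with hA
  have hSV : ∀ s ∈ S, s ∈ G.V ∧ s ∉ F := by
    intro s hs
    have := hS.1.2.1 hs
    simpa [DirHypergraph.remove, DirHypergraph.induced] using this
  have hAV : A ⊆ G'.V := Finset.filter_subset _ _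
  have hV : ∀ y, y ∈ G'.V ↔ (∃ v ∈ G.V, v ∉ F ∧ y = Sum.inl v) ∨
      (∃ v ∈ G.V, v ∈ F ∧ ∃ b, y = Sum.inr (v, b)) := fun y =>
    DirHypergraph.mem_splitSet_s8 F G.V y
  have key := hAB F hF hFcard G' ⟨F, subset_rfl, _, rfl⟩ A (G'.V \ A)
    Finset.disjoint_sdiff (Finset.union_sdiff_of_subset hAV)
  rcases key with key | key
  · rcases key with key | key
    · left
      rw [Finset.eq_empty_iff_forall_notMem] at key ⊢
      intro v hv
      simp only [Finset.mem_sdiff] at hv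
      apply key (Sum.inl v)
      simp only [Finset.mem_sdiff, DirHypergraph.corr, Finset.mem_filter, hA, hV]
      simp [SplitNode.base, hv]
    · right
      intro v hv
      simp only [Finset.mem_sdiff] at hv
      obtain ⟨P, hP, hdis⟩ := key (Sum.inl v) (by
        simp only [Finset.mem_sdiff, DirHypergraph.corr, Finset.mem_filter, hA, hV]
        simp [SplitNode.base, hv])
      -- every node of the paths is an unsplit node
      have hstep : ∀ i k (h : k + 1 < (P i).nodes.length),
          G.IsInNbr (P i).nodes[k].base (P i).nodes[k+1].base ∧
          (P i).nodes[k] = Sum.inl (P i).nodes[k].base ∧ (P i).nodes[k].base ∉ F := by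
        intro i k h
        have h1 := (P i).step k h
        replace h1 := (DirHypergraph.isInNbr_induced _ _ _ _).1 h1
        obtain ⟨h1, h2, h3⟩ := h1
        obtain ⟨h4, h5⟩ := DirHypergraph.split_inNbr G F _ _ h1
        rcases h5 with h5 | h5
        · exact ⟨h4, h5⟩
        · exfalso
          simp only [Finset.mem_sdiff, Finset.mem_inter, DirHypergraph.corr,
            Finset.mem_filter, hA] at h2
          apply h2.2
          refine ⟨⟨h2.1, ?_⟩, h2.1, h5.2⟩
          rw [h5.1]
          simp
      have hlen : ∀ i, 2 ≤ (P i).nodes.length := by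
        intro i
        have h1 := (P i).length_eq
        have h2 := List.length_pos_iff.2 (P i).edges_ne
        omega
      have hlast : ∀ i, (P i).nodes[(P i).nodes.length - 1]'(by have := hlen i; omega)
          = Sum.inl v := fun i => (hP i).2
      have hinl : ∀ i k (h : k < (P i).nodes.length),
          (P i).nodes[k] = Sum.inl (P i).nodes[k].base ∧ (P i).nodes[k].base ∉ F := by
        intro i k h
        by_cases hk : k + 1 < (P i).nodes.length
        · exact (hstep i k hk).2
        · have hk' : k = (P i).nodes.length - 1 := by omega
          subst hk'
          rw [hlast i]
          exact ⟨rfl, hv.2⟩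
      have hinl' : ∀ i, ∀ x ∈ (P i).nodes, x = Sum.inl x.base := by
        intro i x hx
        obtain ⟨k, hk, rfl⟩ := List.mem_iff_getElem.1 hx
        exact (hinl i k hk).1
      have hex : ∀ i, ∃ Q : DirHypergraph.HPath (G.remove F),
          Q.nodes = (P i).nodes.map SplitNode.base := by
        intro i
        apply DirHypergraph.exists_path
        · apply List.Nodup.map_on _ (P i).nodes_nodup
          intro x hx y hy hxy
          rw [hinl' i x hx, hinl' i y hy, hxy]
        · simpa using hlen i
        · intro k h
          simp only [List.length_map] at h
          simp only [List.getElem_map]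
          rw [DirHypergraph.remove, DirHypergraph.isInNbr_induced]
          have h1 := (hstep i k h).1
          refine ⟨h1, ?_, ?_⟩
          · obtain ⟨e, he, h2, h3⟩ := h1
            rw [Finset.mem_sdiff, ← h2]
            exact ⟨(hvalid e he).1, by rw [h2]; exact (hinl i k (by omega)).2⟩
          · obtain ⟨e, he, h2, h3⟩ := h1
            rw [Finset.mem_sdiff]
            exact ⟨(hvalid e he).2.1 h3, (hinl i (k+1) h).2⟩
      choose Q hQ using hex
      refine ⟨Q, ?_, ?_⟩
      · intro i
        constructor
        · have h1 : (Q i).source = (P i).source.base := by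
            simp [DirHypergraph.HPath.source, hQ]
          rw [h1]
          have h2 := Finset.mem_filter.1 (hP i).1
          have h3 : (P i).source = Sum.inl (P i).source.base :=
            hinl' i _ (List.get_mem _ _)
          rcases h2.2 with ⟨s, hs, h4⟩ | ⟨u, h4⟩
          · rw [h4]; exact hs
          · rw [h4] at h3; cases h3
        · have h1 : (Q i).terminal = (P i).terminal.base := by
            simp [DirHypergraph.HPath.terminal, hQ]
          rw [h1, (hP i).2]; rfl
      · intro i j hij x hxi hxj
        rw [hQ, List.mem_map] at hxi hxj
        obtain ⟨y, hy, rfl⟩ := hxi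
        obtain ⟨z, hz, hzy⟩ := hxj
        have hyz : z = y := by rw [hinl' j z hz, hinl' i y hy, hzy]
        subst hyz
        rw [hdis i j hij z hy hz]; rfl
  · exfalso
    obtain ⟨s, hs⟩ := hS.1.1
    have hsA : (Sum.inl s : SplitNode α) ∈ A \ G'.corr F := by
      simp only [Finset.mem_sdiff, DirHypergraph.corr, Finset.mem_filter, hA, hV]
      simp [SplitNode.base, hSV s hs, hs]
    rcases key with key | key
    · rw [key] at hsA; simp at hsA
    · obtain ⟨P, hP, hdis⟩ := key _ hsA
      have hpass : ∀ i, ∃ u ∈ F, (Sum.inr (u, true) : SplitNode α) ∈ (P i).nodes := by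
        intro i
        by_contra hno
        push Not at hno
        have hlen : 0 < (P i).nodes.length := by have := (P i).length_eq; omega
        have hall : ∀ m k (h : k < (P i).nodes.length), k + m = (P i).nodes.length - 1 →
            ∃ t ∈ S, (P i).nodes[k] = Sum.inl t := by
          intro m
          induction m with
          | zero =>
            intro k h hk
            have hk' : k = (P i).nodes.length - 1 := by omega
            subst hk'
            exact ⟨s, hs, (hP i).2⟩
          | succ m ih =>
            intro k h hk
            have hk1 : k + 1 < (P i).nodes.length := by omega
            obtain ⟨t, ht, hkt⟩ := ih (k+1) hk1 (by omega)
            have h1 := (P i).step k hk1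
            replace h1 := (DirHypergraph.isInNbr_induced _ _ _ _).1 h1
            obtain ⟨h1, h2, h3⟩ := h1
            obtain ⟨h4, h5⟩ := DirHypergraph.split_inNbr G F _ _ h1
            rcases h5 with h5 | h5
            · refine ⟨_, ?_, h5.1⟩
              rw [hkt] at h4
              change G.IsInNbr _ t at h4
              have huV : (P i).nodes[k].base ∈ G.V \ F := by
                obtain ⟨e, he, h6, h7⟩ := h4
                rw [Finset.mem_sdiff]
                exact ⟨by rw [← h6]; exact (hvalid e he).1, h5.2⟩
              by_contra hnS
              refine hS.2 _ huV hnS t ht ?_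
              rw [DirHypergraph.remove, DirHypergraph.isInNbr_induced]
              exact ⟨h4, huV, Finset.mem_sdiff.2 (hSV t ht)⟩
            · exfalso
              apply hno _ h5.2
              rw [← h5.1]
              exact List.getElem_mem _
        obtain ⟨t, ht, h0⟩ := hall ((P i).nodes.length - 1) 0 hlen (by omega)
        have h1 := (hP i).1
        change (P i).nodes[0] ∈ _ at h1
        rw [h0, Finset.mem_sdiff] at h1
        apply h1.2
        rw [hA, Finset.mem_filter]
        exact ⟨h1.1, Or.inl ⟨t, ht, rfl⟩⟩
      choose u huF hu using hpass
      have hinj : Function.Injective u := by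
        intro i j hij
        by_contra hne
        have h1 := hdis i j hne _ (hu i) (by rw [hij]; exact hu j)
        cases h1
      have hc := Finset.card_le_card_of_injOn (s := Finset.univ) (t := F) u
        (fun i _ => huF i) hinj.injOn
      simp at hc
      omega
end
end

section
/- If an undirected hypergraph G satisfies condition LCR-hyper, then the underlying simple graph of G is either a complete graph or is (2f + 1)-connected. -/
open scoped Classical

noncomputable section

variable {α : Type} [DecidableEq α]

namespace DirHypergraph

theorem inl_mem_splitSet (X S : Finset α) (v : α) :
    (Sum.inl v : SplitNode α) ∈ splitSet X S ↔ v ∈ S ∧ v ∉ X := by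
  unfold splitSet splitCopies
  simp only [Finset.mem_biUnion]
  constructor
  · rintro ⟨w, hw, h⟩
    split_ifs at h with hX
    · simp at h
    · simp at h; subst h; exact ⟨hw, hX⟩
  · rintro ⟨h1, h2⟩
    exact ⟨v, h1, by simp [h2]⟩

theorem inr_mem_splitSet (X S : Finset α) (v : α) (b : Bool) :
    (Sum.inr (v, b) : SplitNode α) ∈ splitSet X S ↔ v ∈ S ∧ v ∈ X := by
  unfold splitSet splitCopies
  simp only [Finset.mem_biUnion]
  constructor
  · rintro ⟨w, hw, h⟩
    split_ifs at h with hX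
    · have : v = w := by
        simp at h
        rcases h with h | h <;> exact h.1
      subst this; exact ⟨hw, hX⟩
    · simp at h
  · rintro ⟨h1, h2⟩
    exact ⟨v, h1, by cases b <;> simp [h2]⟩

theorem isInNbr_symm {G : DirHypergraph α} (hund : G.IsUndirected) {u v : α}
    (h : G.IsInNbr u v) : G.IsInNbr v u := by
  obtain ⟨e, he, rfl, hv⟩ := h
  exact ⟨_, hund e he v hv, rfl, by simp⟩

theorem no_cut (f : ℕ) (G : DirHypergraph α) (hund : G.IsUndirected)
    (hLCR : G.CondLCRHyper f) (A B D : Finset α) (hV : ∀ x, x ∈ G.V ↔ x ∈ A ∨ x ∈ B ∨ x ∈ D)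
    (hAB : ∀ x ∈ A, x ∉ B) (hAD : ∀ x ∈ A, x ∉ D) (hBD : ∀ x ∈ B, x ∉ D)
    (hA : A.Nonempty) (hB : B.Nonempty) (hD : D.card ≤ 2 * f)
    (hvalid : G.IsValid)
    (hn : ∀ x ∈ A, ∀ y ∈ B, ¬ G.IsInNbr x y) : False := by
  have hn' : ∀ x ∈ A, ∀ y ∈ B, ¬ G.IsInNbr y x := fun x hx y hy h =>
    hn x hx y hy (isInNbr_symm hund h)
  obtain ⟨F, hFD, hFc⟩ := Finset.exists_subset_card_eq (s := D) (n := min f D.card) (by simp)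
  have hFf : F.card ≤ f := by omega
  have hD2 : (D \ F).card ≤ f := by
    rw [Finset.card_sdiff_of_subset hFD]; omega
  have hFV : F ⊆ G.V := fun x hx => (hV x).2 (Or.inr (Or.inr (hFD hx)))
  let a : α × Finset α → Bool := fun e => decide (∃ b ∈ B, b ∈ e.2)
  let pL : SplitNode α → Prop := fun x => (∃ v ∈ A, x = Sum.inl v) ∨ ∃ v, x = Sum.inr (v, false)
  let pR : SplitNode α → Prop := fun x => (∃ v ∈ B, x = Sum.inl v) ∨ ∃ v, x = Sum.inr (v, true)
  have hpLR : ∀ x, pL x → ¬ pR x := by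
    rintro x (⟨v, hv, rfl⟩ | ⟨v, rfl⟩) (⟨w, hw, h⟩ | ⟨w, h⟩) <;> simp at h
    subst h; exact hAB _ hv hw
  let G' := G.splitGraph F a
  have hG'V : G'.V = splitSet F G.V := rfl
  let L := G'.V.filter pL
  let R := G'.V.filter pR
  let C := G'.V.filter (fun x => ¬ pL x ∧ ¬ pR x)
  have hpart : Partition3 L C R G'.V := by
    refine ⟨?_, ?_, ?_, ?_⟩
    · rw [Finset.disjoint_left]; intro x hx hy
      exact (Finset.mem_filter.1 hy).2.1 (Finset.mem_filter.1 hx).2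
    · rw [Finset.disjoint_left]; intro x hx hy
      exact hpLR x (Finset.mem_filter.1 hx).2 (Finset.mem_filter.1 hy).2
    · rw [Finset.disjoint_left]; intro x hx hy
      exact (Finset.mem_filter.1 hx).2.2 (Finset.mem_filter.1 hy).2
    · ext x
      simp only [L, C, R, Finset.mem_union, Finset.mem_filter]
      by_cases h1 : pL x <;> by_cases h2 : pR x <;> simp only [h1, h2] <;> tauto
  have hcard : ((D \ F).image (Sum.inl : α → SplitNode α)).card ≤ f :=
    Finset.card_image_le.trans hD2
  have hR : ∀ y ∈ R \ G'.corr F, ∃ b ∈ B, y = Sum.inl b := by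
    intro y hy
    rw [Finset.mem_sdiff] at hy
    obtain ⟨h1, h2⟩ := hy
    obtain ⟨h1, ⟨v, hv, rfl⟩ | ⟨v, rfl⟩⟩ := Finset.mem_filter.1 h1
    · exact ⟨v, hv, rfl⟩
    · exact absurd (Finset.mem_filter.2 ⟨h1, ((inr_mem_splitSet _ _ _ _).1 h1).2⟩) h2
  have hL : ∀ y ∈ L \ G'.corr F, ∃ b ∈ A, y = Sum.inl b := by
    intro y hy
    rw [Finset.mem_sdiff] at hy
    obtain ⟨h1, h2⟩ := hy
    obtain ⟨h1, ⟨v, hv, rfl⟩ | ⟨v, rfl⟩⟩ := Finset.mem_filter.1 h1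
    · exact ⟨v, hv, rfl⟩
    · exact absurd (Finset.mem_filter.2 ⟨h1, ((inr_mem_splitSet _ _ _ _).1 h1).2⟩) h2
  rcases hLCR F hFV hFf G' ⟨F, subset_rfl, a, rfl⟩ L C R hpart with h | h
  · rcases h with h | h
    · obtain ⟨b, hb⟩ := hB
      have hbF : b ∉ F := fun h => hBD b hb (hFD h)
      have : (Sum.inl b : SplitNode α) ∈ R \ G'.corr F := by
        rw [Finset.mem_sdiff]
        refine ⟨Finset.mem_filter.2 ⟨(inl_mem_splitSet _ _ _).2 ⟨(hV b).2 (by tauto), hbF⟩,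
          Or.inl ⟨b, hb, rfl⟩⟩, fun h => hbF (Finset.mem_filter.1 h).2⟩
      rw [h] at this
      simp at this
    · have hsub : G'.inNbrs (L ∪ C) (R \ G'.corr F) ⊆ (D \ F).image Sum.inl := by
        intro x hx
        obtain ⟨hx, y, hy, e', he', hex, hye⟩ := Finset.mem_filter.1 hx
        obtain ⟨b, hb, rfl⟩ := hR y hy
        obtain ⟨e, he, rfl⟩ := Finset.mem_image.1 he'
        have hbe : b ∈ e.2 := ((inl_mem_splitSet _ _ _).1 hye).1
        have hnR : ¬ pR x := by
          rcases Finset.mem_union.1 hx with h | h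
          · exact hpLR x (Finset.mem_filter.1 h).2
          · exact (Finset.mem_filter.1 h).2.2
        have hae : a e = true := decide_eq_true ⟨b, hb, hbe⟩
        subst hex
        by_cases hF : e.1 ∈ F
        · exact absurd (Or.inr ⟨e.1, by simp [hF, hae]⟩) hnR
        · simp only [hF, if_false] at hnR ⊢
          have h1 : e.1 ∉ B := fun h => hnR (Or.inl ⟨e.1, h, rfl⟩)
          have h2 : e.1 ∉ A := fun h => hn _ h b hb ⟨e, he, rfl, hbe⟩
          have h3 := (hV e.1).1 (hvalid e he).1
          exact Finset.mem_image_of_mem _ (Finset.mem_sdiff.2 ⟨by tauto, hF⟩)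
      have := Finset.card_le_card hsub
      omega
  · rcases h with h | h
    · obtain ⟨b, hb⟩ := hA
      have hbF : b ∉ F := fun h => hAD b hb (hFD h)
      have : (Sum.inl b : SplitNode α) ∈ L \ G'.corr F := by
        rw [Finset.mem_sdiff]
        refine ⟨Finset.mem_filter.2 ⟨(inl_mem_splitSet _ _ _).2 ⟨(hV b).2 (by tauto), hbF⟩,
          Or.inl ⟨b, hb, rfl⟩⟩, fun h => hbF (Finset.mem_filter.1 h).2⟩
      rw [h] at this
      simp at this
    · have hsub : G'.inNbrs (R ∪ C) (L \ G'.corr F) ⊆ (D \ F).image Sum.inl := by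
        intro x hx
        obtain ⟨hx, y, hy, e', he', hex, hye⟩ := Finset.mem_filter.1 hx
        obtain ⟨b, hb, rfl⟩ := hL y hy
        obtain ⟨e, he, rfl⟩ := Finset.mem_image.1 he'
        have hbe : b ∈ e.2 := ((inl_mem_splitSet _ _ _).1 hye).1
        have hnL : ¬ pL x := by
          rcases Finset.mem_union.1 hx with h | h
          · exact fun h' => hpLR x h' (Finset.mem_filter.1 h).2
          · exact (Finset.mem_filter.1 h).2.1
        have hae : a e = false := by
          refine decide_eq_false ?_
          rintro ⟨c, hc, hce⟩
          refine hn b hb c hc ⟨_, hund e he b hbe, rfl, ?_⟩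
          have : c ≠ b := by rintro rfl; exact hAB _ hb hc
          simp [hce, this]
        subst hex
        by_cases hF : e.1 ∈ F
        · exact absurd (Or.inr ⟨e.1, by simp [hF, hae]⟩) hnL
        · simp only [hF, if_false] at hnL ⊢
          have h1 : e.1 ∉ A := fun h => hnL (Or.inl ⟨e.1, h, rfl⟩)
          have h2 : e.1 ∉ B := fun h => hn' b hb _ h ⟨e, he, rfl, hbe⟩
          have h3 := (hV e.1).1 (hvalid e he).1
          exact Finset.mem_image_of_mem _ (Finset.mem_sdiff.2 ⟨by tauto, hF⟩)
      have := Finset.card_le_card hsub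
      omega

end DirHypergraph

/-- If an undirected hypergraph satisfies condition LCR-hyper, then
its underlying simple graph is either complete or `(2f + 1)`-connected. -/
theorem stmt_10 {α : Type} [DecidableEq α] (f : ℕ) (G : DirHypergraph α)
    (hvalid : G.IsValid) (hund : G.IsUndirected)
    (hLCR : G.CondLCRHyper f) :
    (∀ u ∈ G.V, ∀ v ∈ G.V, u ≠ v → G.IsInNbr u v) ∨
      KConnected G.V (fun u v => G.IsInNbr u v) (2 * f + 1) := by
  by_cases hc : ∀ u ∈ G.V, ∀ v ∈ G.V, u ≠ v → G.IsInNbr u v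
  · exact Or.inl hc
  right
  push Not at hc
  obtain ⟨u, hu, v, hv, huv, hnuv⟩ := hc
  have hcard : 2 * f + 1 + 1 ≤ G.V.card := by
    by_contra hlt
    have h2 : ({u, v} : Finset α) ⊆ G.V := by
      intro x hx
      simp only [Finset.mem_insert, Finset.mem_singleton] at hx
      rcases hx with rfl | rfl <;> assumption
    refine DirHypergraph.no_cut f G hund hLCR {u} {v} (G.V \ {u, v}) ?_ ?_ ?_ ?_
      (by simp) (by simp) ?_ hvalid ?_
    · intro x
      simp only [Finset.mem_singleton, Finset.mem_sdiff, Finset.mem_insert]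
      constructor
      · tauto
      · rintro (rfl | rfl | h)
        · exact hu
        · exact hv
        · exact h.1
    · simpa using huv
    · simp
    · simp
    · rw [Finset.card_sdiff_of_subset h2, Finset.card_pair huv]; omega
    · simpa using hnuv
  refine ⟨hcard, fun D hDV hD => ⟨?_, ?_⟩⟩
  · rw [← Finset.card_pos, Finset.card_sdiff_of_subset hDV]; omega
  · intro p hp q hq
    by_contra hpq
    let r : α → α → Prop := fun a b => a ∈ G.V \ D ∧ b ∈ G.V \ D ∧ G.IsInNbr a b
    refine DirHypergraph.no_cut f G hund hLCR
      ((G.V \ D).filter (fun x => Relation.ReflTransGen r p x))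
      ((G.V \ D).filter (fun x => ¬ Relation.ReflTransGen r p x)) D ?_ ?_ ?_ ?_
      ⟨p, Finset.mem_filter.2 ⟨hp, Relation.ReflTransGen.refl⟩⟩
      ⟨q, Finset.mem_filter.2 ⟨hq, hpq⟩⟩ (by omega) hvalid ?_
    · intro x
      have := @hDV x
      simp only [Finset.mem_filter, Finset.mem_sdiff]
      tauto
    · intro x hx hy
      exact (Finset.mem_filter.1 hy).2 (Finset.mem_filter.1 hx).2
    · intro x hx
      exact (Finset.mem_sdiff.1 (Finset.mem_filter.1 hx).1).2
    · intro x hx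
      exact (Finset.mem_sdiff.1 (Finset.mem_filter.1 hx).1).2
    · intro x hx y hy h
      rw [Finset.mem_filter] at hx hy
      exact hy.2 (hx.2.tail ⟨hx.1, hy.1, h⟩)
end
end

section
/- An undirected hypergraph G = (V, E) on n nodes satisfies condition LCR-hyper if all three of the following hold: (1) n ≥ 2f + 1; (2) the underlying simple graph of G is either a complete graph or is (2f + 1)-connected; (3) for every V₁, V₂, V₃ ⊆ V with V₁ ∪ V₂ ∪ V₃ = V and |V₁| = |V₂| = |V₃| = f, there exist nodes u ∈ V₁ \ (V₂ ∪ V₃), v ∈ V₂ \ (V₁ ∪ V₃), and w ∈ V₃ \ (V₁ ∪ V₂) such that {u, v, w} is contained in an undirected hyperedge of G. -/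
open scoped Classical

noncomputable section

variable {α : Type} [DecidableEq α]

namespace DirHypergraph

/-- The head of the image of a hyperedge under splitting. -/
def headCopy (X : Finset α) (a : α × Finset α → Bool) (e : α × Finset α) : SplitNode α :=
  if e.1 ∈ X then Sum.inr (e.1, a e) else Sum.inl e.1

lemma headCopy_base (X : Finset α) (a : α × Finset α → Bool) (e : α × Finset α) :
    (headCopy X a e).base = e.1 := by
  unfold headCopy
  split_ifs <;> rfl

lemma headCopy_mem (G : DirHypergraph α) (X : Finset α) (a : α × Finset α → Bool)
    (e : α × Finset α) (he : e.1 ∈ G.V) : headCopy X a e ∈ (G.splitGraph X a).V := by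
  simp only [splitGraph, splitSet, Finset.mem_biUnion]
  refine ⟨e.1, he, ?_⟩
  unfold headCopy splitCopies
  split_ifs
  · cases a e <;> simp
  · simp

lemma inl_mem (G : DirHypergraph α) (X : Finset α) (a : α × Finset α → Bool)
    (v : α) (hv : v ∈ G.V) (hx : v ∉ X) : (Sum.inl v : SplitNode α) ∈ (G.splitGraph X a).V := by
  simp only [splitGraph, splitSet, Finset.mem_biUnion]
  exact ⟨v, hv, by simp [splitCopies, hx]⟩

lemma eq_inl_of_mem (G : DirHypergraph α) (X : Finset α) (a : α × Finset α → Bool)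
    (x : SplitNode α) (hv : x ∈ (G.splitGraph X a).V) (hx : x.base ∉ X) :
    x.base ∈ G.V ∧ x = Sum.inl x.base := by
  simp only [splitGraph, splitSet, Finset.mem_biUnion] at hv
  obtain ⟨v, hv, h⟩ := hv
  unfold splitCopies at h
  split_ifs at h with hX
  · simp only [Finset.mem_insert, Finset.mem_singleton] at h
    rcases h with rfl | rfl <;> exact absurd hX hx
  · simp only [Finset.mem_singleton] at h
    subst h
    exact ⟨hv, rfl⟩

lemma headCopy_nbr (G : DirHypergraph α) (X : Finset α) (a : α × Finset α → Bool)
    (e : α × Finset α) (he : e ∈ G.E) (v : α) (hv : v ∈ e.2) (hx : v ∉ X) :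
    (G.splitGraph X a).IsInNbr (headCopy X a e) (Sum.inl v) := by
  refine ⟨(headCopy X a e, splitSet X e.2), ?_, rfl, ?_⟩
  · exact Finset.mem_image.2 ⟨e, he, rfl⟩
  · simp only [splitSet, Finset.mem_biUnion]
    exact ⟨v, hv, by simp [splitCopies, hx]⟩

lemma IsUndirected.symm {G : DirHypergraph α} (h : G.IsUndirected) {u v : α}
    (huv : G.IsInNbr u v) : G.IsInNbr v u := by
  obtain ⟨e, he, rfl, hv⟩ := huv
  exact ⟨_, h e he v hv, rfl, by simp⟩

lemma cover (f : ℕ) (G : DirHypergraph α) (hund : G.IsUndirected)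
    (h2 : (∀ u ∈ G.V, ∀ v ∈ G.V, u ≠ v → G.IsInNbr u v) ∨
      KConnected G.V (fun u v => G.IsInNbr u v) (2 * f + 1))
    (F X : Finset α) (hF : F ⊆ G.V) (hFc : F.card ≤ f) (hX : X ⊆ F) (a : α × Finset α → Bool)
    (A R : Finset (SplitNode α)) (hd : Disjoint A R) (hu : A ∪ R = (G.splitGraph X a).V)
    (hna : ¬ Adjacent f (G.splitGraph X a) A (R \ (G.splitGraph X a).corr F)) :
    ∀ v ∈ G.V, v ∉ F → Sum.inl v ∈ A →
      v ∈ ((G.splitGraph X a).inNbrs A (R \ (G.splitGraph X a).corr F)).image SplitNode.base := by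
  intro v hv hvF hvA
  unfold Adjacent at hna
  push Not at hna
  obtain ⟨hne, hcard⟩ := hna
  set G' := G.splitGraph X a with hG'
  set N := G'.inNbrs A (R \ G'.corr F) with hN
  obtain ⟨x, hx⟩ := hne
  simp only [Finset.mem_sdiff] at hx
  have hxV : x ∈ G'.V := hu ▸ Finset.mem_union_right _ hx.1
  have hxF : x.base ∉ F := fun h => hx.2 (by simp [corr, hxV, h])
  obtain ⟨hrV, hxe⟩ := eq_inl_of_mem G X a x hxV (fun h => hxF (hX h))
  set r := x.base with hr
  have hrR : (Sum.inl r : SplitNode α) ∈ R := hxe ▸ hx.1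
  -- key step
  have key : ∀ b c, b ∈ G.V → b ∉ F → Sum.inl b ∈ A → c ∈ G.V → c ∉ F → Sum.inl c ∈ R →
      G.IsInNbr b c → b ∈ N.image SplitNode.base := by
    intro b c hb hbF hbA hc hcF hcR hbc
    obtain ⟨e, he, rfl, hce⟩ := hbc
    refine Finset.mem_image.2 ⟨Sum.inl e.1, ?_, rfl⟩
    have := headCopy_nbr G X a e he c hce (fun h => hcF (hX h))
    rw [headCopy, if_neg (fun h => hbF (hX h))] at this
    refine Finset.mem_filter.2 ⟨hbA, Sum.inl c, ?_, this⟩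
    simp only [Finset.mem_sdiff]
    refine ⟨hcR, fun h => hcF ?_⟩
    exact (Finset.mem_filter.1 h).2
  rcases h2 with h2 | h2
  · refine key v r hv hvF hvA hrV hxF hrR (h2 v hv r hrV ?_)
    intro h
    rw [← h] at hrR
    exact Finset.disjoint_left.1 hd hvA hrR
  · by_contra hvN
    have hDc : ((N.image SplitNode.base ∩ G.V) ∪ F).card < 2 * f + 1 := by
      have h1 := Finset.card_union_le (N.image SplitNode.base ∩ G.V) F
      have h2 := Finset.card_le_card
        (Finset.inter_subset_left : N.image SplitNode.base ∩ G.V ⊆ N.image SplitNode.base)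
      have h3 := Finset.card_image_le (s := N) (f := SplitNode.base)
      omega
    have hcon := (h2.2 _ (Finset.union_subset Finset.inter_subset_right hF) hDc).2
    have hrN : r ∉ N.image SplitNode.base := by
      intro h
      obtain ⟨y, hy, hyr⟩ := Finset.mem_image.1 h
      have hyA : y ∈ A := (Finset.mem_filter.1 hy).1
      have hyV : y ∈ G'.V := hu ▸ Finset.mem_union_left _ hyA
      have := (eq_inl_of_mem G X a y hyV (fun h => hxF (hX (hyr ▸ h)))).2
      rw [hyr] at this
      exact Finset.disjoint_left.1 hd hyA (this ▸ hrR)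
    have hpath := hcon r (by simp [hrV, hxF, hrN]) v (by simp only [Finset.mem_sdiff, Finset.mem_union, Finset.mem_inter]; tauto)
    have : (Sum.inl v : SplitNode α) ∈ R := by
      clear hvA hvN
      induction hpath with
      | refl => exact hrR
      | @tail b c _ hbc ih =>
        obtain ⟨hb, hc, hbc⟩ := hbc
        simp only [Finset.mem_sdiff, Finset.mem_union, Finset.mem_inter, not_or, not_and] at hb hc
        have hbR := ih hb.1 hb.2.2
        have hcV := inl_mem G X a c hc.1 (fun h => hc.2.2 (hX h))
        rw [← hG', ← hu, Finset.mem_union] at hcV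
        rcases hcV with hcA | hcR
        · exact absurd hc.1 (hc.2.1 (key c b hc.1 hc.2.2 hcA hb.1 hb.2.2 hbR (hund.symm hbc)))
        · exact hcR
    exact Finset.disjoint_left.1 hd hvA this

end DirHypergraph

/-- An undirected hypergraph on `n` nodes satisfies condition
LCR-hyper if (1) `n ≥ 2f + 1`, (2) its underlying simple graph is complete or
`(2f + 1)`-connected, and (3) for every cover `V₁ ∪ V₂ ∪ V₃ = V` by sets of size
`f` there is an undirected hyperedge crossing the three private parts. -/
theorem stmt_12 {α : Type} [DecidableEq α] (f : ℕ) (G : DirHypergraph α)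
    (hvalid : G.IsValid) (hund : G.IsUndirected)
    (h1 : 2 * f + 1 ≤ G.V.card)
    (h2 : (∀ u ∈ G.V, ∀ v ∈ G.V, u ≠ v → G.IsInNbr u v) ∨
      KConnected G.V (fun u v => G.IsInNbr u v) (2 * f + 1))
    (h3 : ∀ V₁ V₂ V₃ : Finset α, V₁ ⊆ G.V → V₂ ⊆ G.V → V₃ ⊆ G.V →
      V₁ ∪ V₂ ∪ V₃ = G.V → V₁.card = f → V₂.card = f → V₃.card = f →
      ∃ u ∈ V₁ \ (V₂ ∪ V₃), ∃ v ∈ V₂ \ (V₁ ∪ V₃), ∃ w ∈ V₃ \ (V₁ ∪ V₂),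
        G.InUHyperedge {u, v, w}) :
    G.CondLCRHyper f := by
  intro F hF hFc G' hG' L C R hpart
  obtain ⟨X, hX, a, rfl⟩ := hG'
  obtain ⟨hLC, hLR, hCR, hU⟩ := hpart
  by_contra hcon
  rw [not_or] at hcon
  obtain ⟨hnR, hnL⟩ := hcon
  have hdR : Disjoint (L ∪ C) R := Finset.disjoint_union_left.2 ⟨hLR, hCR⟩
  have hdL : Disjoint (R ∪ C) L := Finset.disjoint_union_left.2 ⟨hLR.symm, hLC.symm⟩
  have hU' : (R ∪ C) ∪ L = (G.splitGraph X a).V := by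
    rw [← hU]; ext; simp only [Finset.mem_union]; tauto
  have cR := DirHypergraph.cover f G hund h2 F X hF hFc hX a _ _ hdR hU hnR
  have cL := DirHypergraph.cover f G hund h2 F X hF hFc hX a _ _ hdL hU' hnL
  have cardR : ((G.splitGraph X a).inNbrs (L ∪ C) (R \ (G.splitGraph X a).corr F)).card ≤ f := by
    unfold DirHypergraph.Adjacent at hnR; push Not at hnR; omega
  have cardL : ((G.splitGraph X a).inNbrs (R ∪ C) (L \ (G.splitGraph X a).corr F)).card ≤ f := by
    unfold DirHypergraph.Adjacent at hnL; push Not at hnL; omega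
  set NR := (G.splitGraph X a).inNbrs (L ∪ C) (R \ (G.splitGraph X a).corr F) with hNR
  set NL := (G.splitGraph X a).inNbrs (R ∪ C) (L \ (G.splitGraph X a).corr F) with hNL
  have ext : ∀ S : Finset α, S.card ≤ f → ∃ T, S ∩ G.V ⊆ T ∧ T ⊆ G.V ∧ T.card = f := by
    intro S hS
    exact Finset.exists_subsuperset_card_eq Finset.inter_subset_right
      ((Finset.card_le_card Finset.inter_subset_left).trans hS) (by omega)
  obtain ⟨V₁, s1, t1, k1⟩ := ext (NR.image SplitNode.base) (Finset.card_image_le.trans cardR)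
  obtain ⟨V₂, s2, t2, k2⟩ := ext (NL.image SplitNode.base) (Finset.card_image_le.trans cardL)
  obtain ⟨V₃, s3, t3, k3⟩ := ext F hFc
  have inF : ∀ x ∈ G.V, x ∉ V₃ → x ∉ F := fun x hx h hF' =>
    h (s3 (Finset.mem_inter.2 ⟨hF', hx⟩))
  have loc : ∀ x ∈ G.V, x ∉ F → (Sum.inl x : SplitNode α) ∈ L ∨
      (Sum.inl x : SplitNode α) ∈ C ∨ (Sum.inl x : SplitNode α) ∈ R := by
    intro x hx hxF
    have := DirHypergraph.inl_mem G X a x hx (fun h => hxF (hX h))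
    rw [← hU] at this
    simp only [Finset.mem_union] at this
    tauto
  have m1 : ∀ x ∈ G.V, x ∉ F → (Sum.inl x : SplitNode α) ∈ L ∪ C → x ∈ V₁ := fun x hx hxF h =>
    s1 (Finset.mem_inter.2 ⟨cR x hx hxF h, hx⟩)
  have m2 : ∀ x ∈ G.V, x ∉ F → (Sum.inl x : SplitNode α) ∈ R ∪ C → x ∈ V₂ := fun x hx hxF h =>
    s2 (Finset.mem_inter.2 ⟨cL x hx hxF h, hx⟩)
  simp only [Finset.mem_union] at m1 m2
  have hcov : V₁ ∪ V₂ ∪ V₃ = G.V := by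
    apply Finset.Subset.antisymm
    · exact Finset.union_subset (Finset.union_subset t1 t2) t3
    · intro x hx
      simp only [Finset.mem_union]
      by_cases h : x ∈ V₃
      · exact Or.inr h
      · have hxF := inF x hx h
        rcases loc x hx hxF with h' | h' | h'
        · exact Or.inl (Or.inl (m1 x hx hxF (Or.inl h')))
        · exact Or.inl (Or.inl (m1 x hx hxF (Or.inr h')))
        · exact Or.inl (Or.inr (m2 x hx hxF (Or.inl h')))
  obtain ⟨u, hu, v, hv, w, hw, e, he, hsub⟩ := h3 V₁ V₂ V₃ t1 t2 t3 hcov k1 k2 k3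
  simp only [Finset.mem_sdiff, Finset.mem_union, not_or] at hu hv hw
  have huF := inF u (t1 hu.1) hu.2.2
  have hvF := inF v (t2 hv.1) hv.2.2
  have huL : (Sum.inl u : SplitNode α) ∈ L := by
    rcases loc u (t1 hu.1) huF with h | h | h
    · exact h
    · exact absurd (m2 u (t1 hu.1) huF (Or.inr h)) hu.2.1
    · exact absurd (m2 u (t1 hu.1) huF (Or.inl h)) hu.2.1
  have hvR : (Sum.inl v : SplitNode α) ∈ R := by
    rcases loc v (t2 hv.1) hvF with h | h | h
    · exact absurd (m1 v (t2 hv.1) hvF (Or.inl h)) hv.2.1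
    · exact absurd (m1 v (t2 hv.1) hvF (Or.inr h)) hv.2.1
    · exact h
  have hwu : u ≠ w := fun h => hu.2.2 (h ▸ hw.1)
  have hwv : v ≠ w := fun h => hv.2.2 (h ▸ hw.1)
  have hue : u = e.1 ∨ u ∈ e.2 := by simpa using hsub (by simp : u ∈ ({u, v, w} : Finset α))
  have hve : v = e.1 ∨ v ∈ e.2 := by simpa using hsub (by simp : v ∈ ({u, v, w} : Finset α))
  have hwe : w = e.1 ∨ w ∈ e.2 := by simpa using hsub (by simp : w ∈ ({u, v, w} : Finset α))
  obtain ⟨e', he', hw1, hu2, hv2⟩ : ∃ e' ∈ G.E, e'.1 = w ∧ u ∈ e'.2 ∧ v ∈ e'.2 := by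
    rcases hwe with h | h
    · subst h
      exact ⟨e, he, rfl, hue.resolve_left hwu, hve.resolve_left hwv⟩
    · refine ⟨_, hund e he w h, rfl, ?_, ?_⟩ <;>
        simp only [Finset.mem_union, Finset.mem_sdiff, Finset.mem_singleton]
      · exact hue.elim Or.inr (fun h' => Or.inl ⟨h', hwu⟩)
      · exact hve.elim Or.inr (fun h' => Or.inl ⟨h', hwv⟩)
  have hzV := DirHypergraph.headCopy_mem G X a e' (hvalid e' he').1
  have hzu := DirHypergraph.headCopy_nbr G X a e' he' u hu2 (fun h => huF (hX h))
  have hzv := DirHypergraph.headCopy_nbr G X a e' he' v hv2 (fun h => hvF (hX h))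
  have hzb := DirHypergraph.headCopy_base X a e'
  rw [hw1] at hzb
  set z := DirHypergraph.headCopy X a e'
  have hz1 : z ∉ L ∪ C := by
    intro hz
    refine hw.2.1 (s1 (Finset.mem_inter.2 ⟨Finset.mem_image.2 ⟨z, ?_, hzb⟩, t3 hw.1⟩))
    refine Finset.mem_filter.2 ⟨hz, Sum.inl v, ?_, hzv⟩
    exact Finset.mem_sdiff.2 ⟨hvR, fun h => hvF (Finset.mem_filter.1 h).2⟩
  have hz2 : z ∉ R ∪ C := by
    intro hz
    refine hw.2.2 (s2 (Finset.mem_inter.2 ⟨Finset.mem_image.2 ⟨z, ?_, hzb⟩, t3 hw.1⟩))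
    refine Finset.mem_filter.2 ⟨hz, Sum.inl u, ?_, hzu⟩
    exact Finset.mem_sdiff.2 ⟨huL, fun h => huF (Finset.mem_filter.1 h).2⟩
  rw [← hU] at hzV
  simp only [Finset.mem_union] at hz1 hz2 hzV
  rcases hzV with (h | h) | h
  · exact hz1 (Or.inl h)
  · exact hz1 (Or.inr h)
  · exact hz2 (Or.inl h)
end
end

section
/- For every natural number f > 2, setting n = 3f − 1 (so that 2f < n ≤ 3f), there exists an undirected (2,3)-hypergraph G = (V, E) on n nodes such that: (i) for every V₁, V₂, V₃ ⊆ V with V₁ ∪ V₂ ∪ V₃ = V and |V₁| = |V₂| = |V₃| = f, there exist nodes u ∈ V₁ \ (V₂ ∪ V₃), v ∈ V₂ \ (V₁ ∪ V₃), and w ∈ V₃ \ (V₁ ∪ V₂) such that {u, v, w} is an undirected hyperedge of G; and (ii) G is not (3, f)-hyper-(3f − n + 1)-connected. (This refutes Lemma 3 of Ravikant et al.) -/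
/-- `(ℓ, t)`-hyper-`k`-connectivity of an undirected hypergraph `(V, E)` (where
each undirected hyperedge is a subset of `V`): for every set `C` of exactly
`k − 1` nodes and every partition of `V \ C` into `ℓ` non-empty sets, each of
size at most `t`, some hyperedge meets every set of the partition. -/
def HyperKConn (V : Finset ℕ) (E : Finset (Finset ℕ)) (ℓ t k : ℕ) : Prop :=
  ∀ C ⊆ V, C.card = k - 1 →
    ∀ P : Fin ℓ → Finset ℕ,
      (∀ i, (P i).Nonempty ∧ (P i).card ≤ t) →
      (∀ i j, i ≠ j → Disjoint (P i) (P j)) →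
      Finset.univ.biUnion P = V \ C →
      ∃ e ∈ E, ∀ i, (e ∩ P i).Nonempty

theorem card_priv (f : ℕ) (V A B C : Finset ℕ) (hV : V.card = 3 * f - 1)
    (h : V ⊆ A ∪ B ∪ C) (hB : B.card = f) (hC : C.card = f) :
    f - 1 ≤ (A \ (B ∪ C)).card := by
  have h1 : V ⊆ (A \ (B ∪ C)) ∪ (B ∪ C) := by
    intro x hx
    have := h hx
    simp only [Finset.mem_union, Finset.mem_sdiff] at this ⊢
    tauto
  have h2 := Finset.card_le_card h1
  have h3 := Finset.card_union_le (A \ (B ∪ C)) (B ∪ C)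
  have h4 := Finset.card_union_le B C
  omega

theorem small_absurd (f : ℕ) (hf : 2 < f) (A : Finset ℕ) (hA : f - 1 ≤ A.card)
    (h : ∀ x ∈ A, 2 * f ≤ x ∧ x < 3 * f - 2) : False := by
  have h1 : A ⊆ Finset.Ico (2 * f) (3 * f - 2) := by
    intro x hx
    simpa using h x hx
  have h2 := Finset.card_le_card h1
  rw [Nat.card_Ico] at h2
  omega

def tri (f u v w : ℕ) : Prop :=
  (u < f ∨ v < f ∨ w < f) ∧
  ((f ≤ u ∧ u < 2 * f) ∨ (f ≤ v ∧ v < 2 * f) ∨ (f ≤ w ∧ w < 2 * f)) ∧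
  ((2 * f ≤ u ∧ u < 3 * f - 2) ∨ (2 * f ≤ v ∧ v < 3 * f - 2) ∨ (2 * f ≤ w ∧ w < 3 * f - 2))

theorem tri_absurd (f : ℕ) (hf : 2 < f) (A B D : Finset ℕ) (hA : f - 1 ≤ A.card)
    (hB : f - 1 ≤ B.card) (hD : f - 1 ≤ D.card)
    (h : ∀ u ∈ A, ∀ v ∈ B, ∀ w ∈ D, tri f u v w) : False := by
  obtain ⟨u, hu⟩ : A.Nonempty := Finset.card_pos.mp (by omega)
  obtain ⟨v, hv⟩ : B.Nonempty := Finset.card_pos.mp (by omega)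
  obtain ⟨w, hw⟩ : D.Nonempty := Finset.card_pos.mp (by omega)
  have h0 := h u hu v hv w hw
  unfold tri at h h0
  rcases h0.2.2 with h1 | h1 | h1
  · refine small_absurd f hf A hA fun x hx => ?_
    have := h x hx v hv w hw
    omega
  · refine small_absurd f hf B hB fun x hx => ?_
    have := h u hu x hx w hw
    omega
  · refine small_absurd f hf D hD fun x hx => ?_
    have := h u hu v hv x hx
    omega

/-- For every `f > 2` and `n = 3f − 1` (so `2f < n ≤ 3f`), there is
an undirected `(2,3)`-hypergraph on `n` nodes that satisfies the crossing
condition (i) yet is not `(3, f)`-hyper-`(3f − n + 1)`-connected; this refutes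
Lemma 3 of Ravikant et al. -/
theorem stmt_14 (f : ℕ) (hf : 2 < f) :
    ∃ (V : Finset ℕ) (E : Finset (Finset ℕ)),
      V.card = 3 * f - 1 ∧
      (∀ e ∈ E, e ⊆ V ∧ (e.card = 2 ∨ e.card = 3)) ∧
      (∀ V₁ V₂ V₃ : Finset ℕ, V₁ ⊆ V → V₂ ⊆ V → V₃ ⊆ V →
        V₁ ∪ V₂ ∪ V₃ = V → V₁.card = f → V₂.card = f → V₃.card = f →
        ∃ u ∈ V₁ \ (V₂ ∪ V₃), ∃ v ∈ V₂ \ (V₁ ∪ V₃), ∃ w ∈ V₃ \ (V₁ ∪ V₂),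
          ({u, v, w} : Finset ℕ) ∈ E) ∧
      ¬ HyperKConn V E 3 f (3 * f - (3 * f - 1) + 1) := by
  classical
  let P : Fin 3 → Finset ℕ :=
    ![Finset.range f, Finset.Ico f (2 * f), Finset.Ico (2 * f) (3 * f - 2)]
  refine ⟨Finset.range (3 * f - 1),
    ((Finset.range (3 * f - 1)).powersetCard 3).filter
      (fun e => ¬ ∀ i, (e ∩ P i).Nonempty), by simp, ?_, ?_, ?_⟩
  · intro e he
    simp only [Finset.mem_filter, Finset.mem_powersetCard] at he
    exact ⟨he.1.1, Or.inr he.1.2⟩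
  · intro V₁ V₂ V₃ s1 s2 s3 hU c1 c2 c3
    by_contra hcon
    have hc : (Finset.range (3 * f - 1)).card = 3 * f - 1 := by simp
    refine tri_absurd f hf (V₁ \ (V₂ ∪ V₃)) (V₂ \ (V₁ ∪ V₃)) (V₃ \ (V₁ ∪ V₂))
      (card_priv f _ _ _ _ hc (by rw [hU]) c2 c3)
      (card_priv f _ _ _ _ hc (by rw [← hU, Finset.union_comm V₁ V₂]) c1 c3)
      (card_priv f _ _ _ _ hc (by
        rw [← hU]; intro x hx; simp only [Finset.mem_union] at hx ⊢; tauto) c1 c2) ?_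
    intro u hu v hv w hw
    have hne : ({u, v, w} : Finset ℕ) ∉ _ := fun hE => hcon ⟨u, hu, v, hv, w, hw, hE⟩
    simp only [Finset.mem_sdiff, Finset.mem_union, not_or] at hu hv hw
    have huv : u ≠ v := fun h => hv.2.1 (h ▸ hu.1)
    have huw : u ≠ w := fun h => hw.2.1 (h ▸ hu.1)
    have hvw : v ≠ w := fun h => hw.2.2 (h ▸ hv.1)
    have h3 : ({u, v, w} : Finset ℕ).card = 3 := Finset.card_eq_three.mpr
      ⟨u, v, w, huv, huw, hvw, rfl⟩
    have hsub : ({u, v, w} : Finset ℕ) ⊆ Finset.range (3 * f - 1) := by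
      intro x hx
      simp only [Finset.mem_insert, Finset.mem_singleton] at hx
      rcases hx with rfl | rfl | rfl
      · exact s1 hu.1
      · exact s2 hv.1
      · exact s3 hw.1
    rw [Finset.mem_filter, Finset.mem_powersetCard] at hne
    have hall : ∀ i, (({u, v, w} : Finset ℕ) ∩ P i).Nonempty := by
      by_contra hn
      exact hne ⟨⟨hsub, h3⟩, hn⟩
    obtain ⟨x, hx⟩ := hall 0
    obtain ⟨y, hy⟩ := hall 1
    obtain ⟨z, hz⟩ := hall 2
    simp [P] at hx hy hz
    unfold tri
    refine ⟨?_, ?_, ?_⟩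
    · rcases hx with ⟨rfl | rfl | rfl, hx⟩ <;> simp [hx]
    · rcases hy with ⟨rfl | rfl | rfl, hy⟩ <;> simp [hy]
    · rcases hz with ⟨rfl | rfl | rfl, hz⟩ <;> simp [hz]
  · intro H
    obtain ⟨e, he, h⟩ := H {3 * f - 2} (by
        intro x hx
        simp only [Finset.mem_singleton] at hx
        simp only [Finset.mem_range]; omega) (by simp; omega) P
      (by
        intro i
        fin_cases i <;> simp [P] <;> omega)
      (by
        intro i j hij
        rw [Finset.disjoint_left]
        intro x
        fin_cases i <;> fin_cases j <;> simp [P] at hij ⊢ <;> omega)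
      (by
        ext x
        simp [P, Fin.exists_fin_succ]
        omega)
    exact (Finset.mem_filter.mp he).2 h
end
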